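/- arXiv:2605.14456 — 3 statements merged into one kernel-verified Lean document; each statement's English description precedes it below -/
import Mathlib

section
/- Let f ∈ BMO(𝓛_k) and p ∈ [1,∞). Then M_k f is locally p-integrable with respect to ω_k: for every ball B₀ = B(x₀,r₀) with r₀ < ∞, one has ∫_{B₀} (M_k f)^p dω_k < ∞. -/
open MeasureTheory Metric Real
open scoped ENNReal RealInnerProductSpace

set_option linter.unusedVariables false

noncomputable section

/-- `f` satisfies the defining conditions of `BMO(𝓛_k)` with constant `Cf`:
mean oscillation over balls below the critical radius, and average of `|f|` over balls of
at least the critical radius, are bounded by `Cf`.  The `BMO(𝓛_k)` norm of `f` is the least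
such `Cf`. -/
def IsBMOL {α : Type*} [MeasurableSpace α] [PseudoMetricSpace α]
    (μ : Measure α) (ρ : α → ℝ) (f : α → ℝ) (Cf : ℝ) : Prop :=
  (∀ (x : α) (s : ℝ), 0 < s → s < ρ x →
     ⨍ y in Metric.ball x s, |f y - ⨍ z in Metric.ball x s, f z ∂μ| ∂μ ≤ Cf) ∧
  (∀ (x : α) (r : ℝ), ρ x ≤ r → ⨍ y in Metric.ball x r, |f y| ∂μ ≤ Cf)

/-- The uncentered weighted Hardy–Littlewood maximal function
`M_k f(x) = sup {ω_k(B)⁻¹ ∫_B |f| dω_k : B a ball containing x}`. -/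
def maximalFn {α : Type*} [MeasurableSpace α] [PseudoMetricSpace α]
    (μ : Measure α) (f : α → ℝ) (x : α) : ℝ≥0∞ :=
  ⨆ (y : α) (r : ℝ) (_ : x ∈ Metric.ball y r),
    (μ (Metric.ball y r))⁻¹ * ∫⁻ z in Metric.ball y r, ENNReal.ofReal |f z| ∂μ

section JohnNirenberg

open scoped NNReal

variable {X : Type*} [MeasurableSpace X] {μ : Measure X} {f : X → ℝ} {m : X → ℝ → ℝ} {A D : ℝ≥0}

lemma lintegral_enorm_sub_le (s : Set X) (a b : ℝ) :
    ∫⁻ y in s, ‖f y - a‖ₑ ∂μ ≤ ∫⁻ y in s, ‖f y - b‖ₑ ∂μ + ‖a - b‖ₑ * μ s := by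
  rw [← setLIntegral_const, ← lintegral_add_right _ measurable_const]
  refine lintegral_mono fun y => ?_
  calc ‖f y - a‖ₑ = ‖(f y - b) - (a - b)‖ₑ := by congr 1; ring
    _ ≤ _ := enorm_sub_le

lemma enorm_sub_mul_measure_le (hf : AEMeasurable f μ) (s : Set X) (a b : ℝ) :
    ‖a - b‖ₑ * μ s ≤ ∫⁻ y in s, ‖f y - a‖ₑ ∂μ + ∫⁻ y in s, ‖f y - b‖ₑ ∂μ := by
  rw [← setLIntegral_const, ← lintegral_add_left' (by fun_prop)]
  refine lintegral_mono fun y => ?_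
  calc ‖a - b‖ₑ = ‖(f y - b) - (f y - a)‖ₑ := by congr 1; ring
    _ ≤ _ := enorm_sub_le.trans_eq (add_comm _ _)

variable [PseudoMetricSpace X]

/-- Balls have positive finite measure, and enlarging a ball fifteen times multiplies its measure
by at most `D`. -/
structure IsBallDoubling (μ : Measure X) (D : ℝ≥0) : Prop where
  ne_top : ∀ x r, μ (ball x r) ≠ ∞
  ne_zero : ∀ x r, 0 < r → μ (ball x r) ≠ 0
  enlarge : ∀ x r, 0 < r → μ (ball x (15 * r)) ≤ D * μ (ball x r)

/-- The mean of `|f - m x r|` over the ball `B(x, r)` is at most `A`. -/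
def HasOscBound (μ : Measure X) (f : X → ℝ) (m : X → ℝ → ℝ) (A : ℝ≥0) : Prop :=
  ∀ x r, 0 < r → ∫⁻ y in ball x r, ‖f y - m x r‖ₑ ∂μ ≤ A * μ (ball x r)

/-- The points of `B(x, r)` lying in a ball of radius at most `r` on which the mean of
`|f - m x r|` exceeds `t`. -/
def oscSet (μ : Measure X) (f : X → ℝ) (m : X → ℝ → ℝ) (x : X) (r : ℝ) (t : ℝ≥0∞) : Set X :=
  {z ∈ ball x r | ∃ y s, s ≤ r ∧ z ∈ ball y s ∧
    t * μ (ball y s) < ∫⁻ u in ball y s, ‖f u - m x r‖ₑ ∂μ}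

lemma IsBallDoubling.le_of_subset (hD : IsBallDoubling μ D) {x y : X} {r s : ℝ} (hs : 0 < s)
    (h : dist x y + r ≤ 15 * s) : μ (ball x r) ≤ D * μ (ball y s) :=
  (measure_mono (ball_subset_ball' (by linarith))).trans (hD.enlarge y s hs)

lemma lintegral_ball_three_mul_le (hD : IsBallDoubling μ D) (hf : AEMeasurable f μ)
    (hm : HasOscBound μ f m A) {x : X} {r : ℝ} (hr : 0 < r) :
    ∫⁻ y in ball x (3 * r), ‖f y - m x r‖ₑ ∂μ ≤ (A * (D * D + 2 * D) : ℝ≥0) * μ (ball x r) := by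
  have h3 : μ (ball x (3 * r)) ≤ D * μ (ball x r) := hD.le_of_subset hr (by simp; linarith)
  have h1 : ∫⁻ y in ball x (3 * r), ‖f y - m x (3 * r)‖ₑ ∂μ ≤ A * (D * μ (ball x r)) :=
    (hm x (3 * r) (by positivity)).trans (by gcongr)
  have h2 : ‖m x r - m x (3 * r)‖ₑ * μ (ball x r) ≤ A * μ (ball x r) + A * (D * μ (ball x r)) := by
    refine (enorm_sub_mul_measure_le hf _ _ _).trans (add_le_add (hm x r hr) (le_trans ?_ h1))
    exact lintegral_mono_set (ball_subset_ball (by linarith))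
  calc _ ≤ A * (D * μ (ball x r)) + ‖m x r - m x (3 * r)‖ₑ * (D * μ (ball x r)) :=
        (lintegral_enorm_sub_le _ _ (m x (3 * r))).trans (by gcongr)
    _ = A * (D * μ (ball x r)) + D * (‖m x r - m x (3 * r)‖ₑ * μ (ball x r)) := by ring
    _ ≤ A * (D * μ (ball x r)) + D * (A * μ (ball x r) + A * (D * μ (ball x r))) := by gcongr
    _ = _ := by push_cast; ring

lemma oscSet_decay [BorelSpace X] [SecondCountableTopology X] (hD : IsBallDoubling μ D)
    (hf : AEMeasurable f μ)
    (hm : HasOscBound μ f m A) {K : ℝ≥0} (hK0 : K ≠ 0) (hAK : A ≤ K)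
    (hK : 2 * (D * (A * (D * D + 2 * D))) ≤ K) {t φ : ℝ≥0∞}
    (hφ : ∀ x r, 0 < r → μ (oscSet μ f m x r t) ≤ φ * μ (ball x r)) {x : X} {r : ℝ} (hr : 0 < r) :
    2 * μ (oscSet μ f m x r (t + 2 * K)) ≤ φ * μ (ball x r) := by
  set A' : ℝ≥0 := A * (D * D + 2 * D)
  have hlarge := lintegral_ball_three_mul_le hD hf hm (x := x) hr
  have hsub : ∀ y s z, s ≤ r → z ∈ ball x r → z ∈ ball y s → ball y s ⊆ ball x (3 * r) := by
    intro y s z hs hz hz'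
    rw [mem_ball] at hz hz'
    apply ball_subset_ball'
    linarith [dist_triangle_left y x z]
  -- on balls of radius comparable to `r`, the mean is at most `K`
  have hsmall : ∀ y s z, s ≤ r → z ∈ ball x r → z ∈ ball y s →
      K * μ (ball y s) < ∫⁻ u in ball y s, ‖f u - m x r‖ₑ ∂μ → 5 * s < r := by
    intro y s z hs hz hz' hlt
    by_contra! hrs
    have hs0 : 0 < s := pos_of_mem_ball hz'
    refine hlt.not_ge ?_
    have hxy : dist x y < r + s := by
      rw [mem_ball] at hz hz'
      linarith [dist_triangle_left x y z]
    calc _ ≤ (A' : ℝ≥0∞) * μ (ball x r) :=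
          (lintegral_mono_set (hsub y s z hs hz hz')).trans hlarge
      _ ≤ A' * (D * μ (ball y s)) := by
          gcongr; exact hD.le_of_subset hs0 (by linarith)
      _ = ((D * A' : ℝ≥0) : ℝ≥0∞) * μ (ball y s) := by push_cast; ring
      _ ≤ K * μ (ball y s) := by
          gcongr
          refine le_trans ?_ hK
          rw [two_mul]; exact le_self_add
  let S : X → Set ℝ := fun z => {s | ∃ y, s ≤ r ∧ z ∈ ball y s ∧
    K * μ (ball y s) < ∫⁻ u in ball y s, ‖f u - m x r‖ₑ ∂μ}
  have hSbdd : ∀ z, BddAbove (S z) := fun z => ⟨r, fun s ⟨_, h, _⟩ => h⟩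
  set E := oscSet μ f m x r (t + 2 * K)
  have hchoice : ∀ z ∈ E, ∃ p : X × ℝ, p.2 ≤ r ∧ z ∈ ball p.1 p.2 ∧
      K * μ (ball p.1 p.2) < ∫⁻ u in ball p.1 p.2, ‖f u - m x r‖ₑ ∂μ ∧
      ∀ s ∈ S z, s < 2 * p.2 := by
    rintro z ⟨hz, y, s, hs, hzs, hlt⟩
    have hsS : s ∈ S z := by
      refine ⟨y, hs, hzs, lt_of_le_of_lt ?_ hlt⟩
      gcongr
      calc (K : ℝ≥0∞) ≤ K + K := le_self_add
        _ ≤ t + 2 * K := by rw [two_mul]; exact le_add_self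
    have hsup : 0 < sSup (S z) := (pos_of_mem_ball hzs).trans_le (le_csSup (hSbdd z) hsS)
    obtain ⟨s', hs', hlt'⟩ := exists_lt_of_lt_csSup ⟨s, hsS⟩ (half_lt_self hsup)
    obtain ⟨y', h1, h2, h3⟩ := hs'
    refine ⟨(y', s'), h1, h2, h3, fun v hv => ?_⟩
    have := le_csSup (hSbdd z) hv
    linarith
  choose! c hcr hcz hcK hcS using hchoice
  obtain ⟨u, huE, hdisj, hcov⟩ := Vitali.exists_disjoint_subfamily_covering_enlargement
    (fun z => ball (c z).1 (c z).2) E (fun z => (c z).2) 2 one_lt_two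
    (fun z hz => (pos_of_mem_ball (hcz z hz)).le) r (fun z hz => hcr z hz)
    (fun z hz => ⟨z, hcz z hz⟩)
  have hucount : u.Countable := hdisj.countable_of_isOpen (fun _ _ => isOpen_ball)
    (fun z hz => ⟨z, hcz z (huE hz)⟩)
  have hcover : E ⊆ ⋃ z ∈ u, oscSet μ f m (c z).1 (5 * (c z).2) t := by
    intro z hz
    obtain ⟨i, hiu, ⟨v, hv1, hv2⟩, hle⟩ := hcov z hz
    have hiE := huE hiu
    simp only [Set.mem_iUnion]
    refine ⟨i, hiu, ?_⟩
    have hzx : z ∈ ball x r := hz.1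
    have hi0 : 0 < (c i).2 := pos_of_mem_ball hv2
    have hzi : z ∈ ball (c i).1 (5 * (c i).2) := by
      have := hcz z hz
      rw [mem_ball] at this hv1 hv2 ⊢
      have h1 := dist_triangle4 z (c z).1 v (c i).1
      rw [dist_comm (c z).1 v] at h1
      linarith
    have hi5 : 5 * (c i).2 < r := hsmall _ _ i (hcr i hiE) hiE.1 (hcz i hiE) (hcK i hiE)
    set B := ball (c i).1 (5 * (c i).2)
    have hBK : ∫⁻ u in B, ‖f u - m x r‖ₑ ∂μ ≤ K * μ B := by
      by_contra! hlt
      have := hcS z hz _ ⟨(c i).1, hi5.le, hzi, hlt⟩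
      linarith
    have hdiff : ‖m x r - m (c i).1 (5 * (c i).2)‖ₑ ≤ 2 * K := by
      have h0 : μ B ≠ 0 := hD.ne_zero _ _ (by positivity)
      have h1 : μ B ≠ ∞ := hD.ne_top _ _
      rw [← ENNReal.mul_le_mul_iff_left h0 h1]
      refine (enorm_sub_mul_measure_le hf _ _ _).trans ?_
      rw [two_mul, add_mul]
      refine add_le_add hBK ((hm _ _ (by positivity)).trans ?_)
      gcongr
    obtain ⟨y, s, hs, hzs, hlt⟩ := hz.2
    have hsS : s ∈ S z := by
      refine ⟨y, hs, hzs, lt_of_le_of_lt ?_ hlt⟩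
      gcongr
      calc (K : ℝ≥0∞) ≤ K + K := le_self_add
        _ ≤ t + 2 * K := by rw [two_mul]; exact le_add_self
    have hs2 := hcS z hz s hsS
    refine ⟨hzi, y, s, by linarith, hzs, ?_⟩
    by_contra! hcon
    refine hlt.not_ge ((lintegral_enorm_sub_le _ _ (m (c i).1 (5 * (c i).2))).trans ?_)
    rw [add_mul]
    gcongr
  have hsum : K * ∑' z : u, μ (ball (c z).1 (c z).2) ≤ A' * μ (ball x r) := by
    rw [← ENNReal.tsum_mul_left]
    calc _ ≤ ∑' z : u, ∫⁻ v in ball (c z).1 (c z).2, ‖f v - m x r‖ₑ ∂μ :=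
          ENNReal.tsum_le_tsum fun z => (hcK z (huE z.2)).le
      _ = ∫⁻ v in ⋃ z ∈ u, ball (c z).1 (c z).2, ‖f v - m x r‖ₑ ∂μ :=
          (lintegral_biUnion hucount (fun _ _ => measurableSet_ball) hdisj _).symm
      _ ≤ _ := (lintegral_mono_set (Set.iUnion₂_subset fun z hz =>
          hsub _ _ z (hcr z (huE hz)) (huE hz).1 (hcz z (huE hz)))).trans hlarge
  have hμE : μ E ≤ φ * (D * ∑' z : u, μ (ball (c z).1 (c z).2)) := by
    rw [← ENNReal.tsum_mul_left, ← ENNReal.tsum_mul_left]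
    refine (measure_mono hcover).trans ((measure_biUnion_le μ hucount _).trans ?_)
    refine ENNReal.tsum_le_tsum fun z => ?_
    have h0 : 0 < (c z).2 := pos_of_mem_ball (hcz z (huE z.2))
    refine (hφ _ _ (by positivity)).trans ?_
    gcongr
    exact hD.le_of_subset h0 (by simp; linarith)
  have hK0' : (K : ℝ≥0∞) ≠ 0 := by simpa using hK0
  rw [← ENNReal.mul_le_mul_iff_right hK0' ENNReal.coe_ne_top]
  calc K * (2 * μ E) ≤ K * (2 * (φ * (D * ∑' z : u, μ (ball (c z).1 (c z).2)))) := by gcongr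
    _ = 2 * φ * D * (K * ∑' z : u, μ (ball (c z).1 (c z).2)) := by ring
    _ ≤ 2 * φ * D * (A' * μ (ball x r)) := by gcongr
    _ = ((2 * (D * A') : ℝ≥0) : ℝ≥0∞) * (φ * μ (ball x r)) := by push_cast; ring
    _ ≤ K * (φ * μ (ball x r)) := by gcongr

lemma measure_oscSet_le [BorelSpace X] [SecondCountableTopology X] (hD : IsBallDoubling μ D)
    (hf : AEMeasurable f μ) (hm : HasOscBound μ f m A) :
    ∃ L : ℝ≥0, ∀ (j : ℕ) x r, 0 < r →
      μ (oscSet μ f m x r (j * L)) ≤ (2 ^ j)⁻¹ * μ (ball x r) := by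
  set K : ℝ≥0 := 2 * (D * (A * (D * D + 2 * D))) + A + 1
  refine ⟨2 * K, fun j => ?_⟩
  induction j with
  | zero => exact fun x r _ => by simpa using measure_mono fun z hz => hz.1
  | succ j ih =>
    intro x r hr
    have h := oscSet_decay hD hf hm (K := K) (by positivity)
      (le_add_right le_add_self) (le_add_right le_self_add) ih (x := x) hr
    have e : ((j + 1 : ℕ) : ℝ≥0∞) * ((2 * K : ℝ≥0) : ℝ≥0∞)
        = j * ((2 * K : ℝ≥0) : ℝ≥0∞) + 2 * K := by push_cast; ring
    rw [e, pow_succ', ENNReal.mul_inv (by simp) (by simp), mul_assoc]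
    calc _ = 2⁻¹ * (2 * μ (oscSet μ f m x r (j * ((2 * K : ℝ≥0) : ℝ≥0∞) + 2 * K))) := by
          rw [← mul_assoc, ENNReal.inv_mul_cancel two_ne_zero ENNReal.ofNat_ne_top, one_mul]
      _ ≤ _ := by gcongr

/-- A series of shifted powers against geometric weights converges. -/
lemma tsum_add_mul_rpow_mul_lt_top (c L : ℝ≥0) {p : ℝ} (hp : 0 ≤ p) :
    ∑' j : ℕ, ((c + (j + 1) * L : ℝ≥0∞) ^ p * (2 ^ j)⁻¹) < ∞ := by
  set N := ⌈p⌉₊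
  have hsum : Summable fun j : ℕ => ((j : ℝ≥0) + 1) ^ N * (2⁻¹) ^ j := by
    rw [← NNReal.summable_coe]
    have h := (summable_nat_add_iff 1).2
      (summable_pow_mul_geometric_of_norm_lt_one N (r := (2⁻¹ : ℝ)) (by norm_num))
    refine (h.mul_left 2).congr fun j => ?_
    push_cast
    rw [pow_succ]; ring
  have hle : ∀ j : ℕ, ((c + (j + 1) * L : ℝ≥0∞) ^ p * (2 ^ j)⁻¹)
      ≤ (c + L : ℝ≥0∞) ^ p * (((((j : ℝ≥0) + 1) ^ N * (2⁻¹) ^ j : ℝ≥0)) : ℝ≥0∞) := by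
    intro j
    have h1 : (c + (j + 1) * L : ℝ≥0∞) ≤ (c + L) * (j + 1) := by
      rw [add_mul (c : ℝ≥0∞), mul_comm (L : ℝ≥0∞)]
      gcongr
      exact le_mul_of_one_le_right' le_add_self
    have h2 : ((j : ℝ≥0∞) + 1) ^ p ≤ (j + 1) ^ N := by
      rw [← ENNReal.rpow_natCast]
      exact ENNReal.rpow_le_rpow_of_exponent_le le_add_self (Nat.le_ceil p)
    calc _ ≤ ((c + L : ℝ≥0∞) * (j + 1)) ^ p * (2 ^ j)⁻¹ := by gcongr
      _ = (c + L : ℝ≥0∞) ^ p * ((j + 1) ^ p * (2 ^ j)⁻¹) := by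
          rw [ENNReal.mul_rpow_of_nonneg _ _ hp, mul_assoc]
      _ ≤ (c + L : ℝ≥0∞) ^ p * ((j + 1) ^ N * (2 ^ j)⁻¹) := by gcongr
      _ = _ := by
          push_cast
          rw [ENNReal.inv_pow]
  refine (ENNReal.tsum_le_tsum hle).trans_lt ?_
  rw [ENNReal.tsum_mul_left]
  refine ENNReal.mul_lt_top ?_ (ENNReal.tsum_coe_ne_top_iff_summable.2 hsum).lt_top
  exact ENNReal.rpow_lt_top_of_nonneg hp (by simp)

lemma maximalFn_le_of_notMem_oscSet (hD : IsBallDoubling μ D) {x z : X} {r : ℝ} (hr : 0 < r)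
    {t F : ℝ≥0∞} (hF : ∀ s, r ≤ s → ∫⁻ y in ball x s, ‖f y‖ₑ ∂μ ≤ F * μ (ball x s))
    (hz : z ∈ ball x r) (hzt : z ∉ oscSet μ f m x r t) :
    maximalFn μ f z ≤ ‖m x r‖ₑ + D * F + t := by
  refine iSup_le fun y => iSup_le fun s => iSup_le fun hzs => ?_
  have hs0 : 0 < s := pos_of_mem_ball hzs
  have h0 := hD.ne_zero y s hs0
  rw [mul_comm, ← div_eq_mul_inv, ENNReal.div_le_iff h0 (hD.ne_top y s)]
  simp_rw [← Real.enorm_eq_ofReal_abs]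
  rcases le_or_gt s r with hsr | hsr
  · have h1 : ∫⁻ u in ball y s, ‖f u - m x r‖ₑ ∂μ ≤ t * μ (ball y s) := by
      by_contra! h
      exact hzt ⟨hz, y, s, hsr, hzs, h⟩
    have h2 := lintegral_enorm_sub_le (f := f) (μ := μ) (ball y s) 0 (m x r)
    simp only [sub_zero, zero_sub, enorm_neg] at h2
    calc _ ≤ t * μ (ball y s) + ‖m x r‖ₑ * μ (ball y s) := h2.trans (by gcongr)
      _ = (‖m x r‖ₑ + t) * μ (ball y s) := by ring
      _ ≤ _ := by gcongr; exact le_self_add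
  · rw [mem_ball] at hz hzs
    have hxy : dist x y < r + s := by linarith [dist_triangle_left x y z]
    calc _ ≤ ∫⁻ u in ball x (3 * s), ‖f u‖ₑ ∂μ :=
          lintegral_mono_set (ball_subset_ball' (by rw [dist_comm]; linarith))
      _ ≤ F * μ (ball x (3 * s)) := hF _ (by linarith)
      _ ≤ F * (D * μ (ball y s)) := by
          gcongr; exact hD.le_of_subset hs0 (by linarith)
      _ = D * F * μ (ball y s) := by ring
      _ ≤ _ := by gcongr; exact le_add_self.trans le_self_add

/-- On a space with a doubling measure, the maximal function of a function of bounded mean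
oscillation is `p`-integrable over a ball, provided the means of `|f|` over the larger concentric
balls are bounded. -/
theorem lintegral_maximalFn_rpow_lt_top [BorelSpace X] [SecondCountableTopology X]
    (hD : IsBallDoubling μ D)
    (hf : AEMeasurable f μ) (hm : HasOscBound μ f m A) {x : X} {r : ℝ} {F : ℝ≥0}
    (hF : ∀ s, r ≤ s → ∫⁻ y in ball x s, ‖f y‖ₑ ∂μ ≤ F * μ (ball x s)) {p : ℝ} (hp : 0 < p) :
    ∫⁻ z in ball x r, maximalFn μ f z ^ p ∂μ < ∞ := by
  rcases le_or_gt r 0 with hr | hr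
  · simp [ball_eq_empty.2 hr]
  obtain ⟨L, hL⟩ := measure_oscSet_le hD hf hm
  set c : ℝ≥0 := ‖m x r‖₊ + D * F + 1 with hc
  have hlt : ∀ z ∈ ball x r, ∀ t, z ∉ oscSet μ f m x r t → maximalFn μ f z ≤ c + t := by
    intro z hz t ht
    refine (maximalFn_le_of_notMem_oscSet hD hr hF hz ht).trans ?_
    rw [hc]; push_cast
    exact add_le_add_left le_self_add t
  let T : ℕ → Set X := fun j => toMeasurable μ (oscSet μ f m x r (j * L))
  let a : ℕ → ℝ≥0∞ := fun j => (c + (j + 1) * L) ^ p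
  have hpt : ∀ z ∈ ball x r, maximalFn μ f z ^ p
      ≤ c ^ p + ∑' j, (T j).indicator (fun _ => a j) z := by
    intro z hz
    by_cases hall : ∀ j : ℕ, z ∈ oscSet μ f m x r (j * L)
    · have htop : ∑' j, (T j).indicator (fun _ => a j) z = ∞ := by
        rw [eq_top_iff, ← ENNReal.tsum_const_eq_top_of_ne_zero (α := ℕ) one_ne_zero]
        refine ENNReal.tsum_le_tsum fun j => ?_
        rw [Set.indicator_of_mem (subset_toMeasurable _ _ (hall j))]
        refine ENNReal.one_le_rpow ?_ hp
        rw [hc]; push_cast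
        exact le_add_right le_add_self
      simp [htop]
    · push Not at hall
      classical
      rcases hj : Nat.find hall with _ | i
      · have h := Nat.find_spec hall
        rw [hj] at h
        refine le_add_right (ENNReal.rpow_le_rpow ?_ hp.le)
        simpa using hlt z hz _ h
      · have h := Nat.find_spec hall
        have h' := Nat.find_min hall (m := i) (by omega)
        rw [hj] at h
        rw [not_not] at h'
        refine le_add_left (le_trans ?_ (ENNReal.le_tsum i))
        rw [Set.indicator_of_mem (subset_toMeasurable _ _ h')]
        refine ENNReal.rpow_le_rpow ?_ hp.le
        simpa using hlt z hz _ h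
  have hμB : μ (ball x r) < ∞ := (hD.ne_top x r).lt_top
  calc _ ≤ ∫⁻ z in ball x r, (c ^ p + ∑' j, (T j).indicator (fun _ => a j) z) ∂μ :=
        setLIntegral_mono' measurableSet_ball hpt
    _ = c ^ p * μ (ball x r) + ∑' j, ∫⁻ z in ball x r, (T j).indicator (fun _ => a j) z ∂μ := by
        rw [lintegral_add_left measurable_const, setLIntegral_const, lintegral_tsum]
        exact fun j => (measurable_const.indicator (measurableSet_toMeasurable _ _)).aemeasurable
    _ ≤ c ^ p * μ (ball x r) + ∑' j, a j * (2 ^ j)⁻¹ * μ (ball x r) := by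
        gcongr with j
        refine (setLIntegral_le_lintegral _ _).trans ?_
        rw [lintegral_indicator_const (measurableSet_toMeasurable _ _), measure_toMeasurable,
          mul_assoc]
        gcongr
        exact hL j x r hr
    _ < ∞ := by
        rw [ENNReal.tsum_mul_right]
        refine ENNReal.add_lt_top.2 ⟨ENNReal.mul_lt_top ?_ hμB,
          ENNReal.mul_lt_top (tsum_add_mul_rpow_mul_lt_top c L hp.le) hμB⟩
        exact ENNReal.rpow_lt_top_of_nonneg hp.le ENNReal.coe_ne_top

end JohnNirenberg

section RootWeight

open scoped NNReal

variable {n : ℕ}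

local notation "𝔼" => EuclideanSpace ℝ (Fin n)

/-- Every ball contains a ball of comparable radius staying away from finitely many hyperplanes. -/
lemma exists_ball_away_from_hyperplanes (S : Finset 𝔼) (hS : (0 : 𝔼) ∉ S) :
    ∃ c : ℝ, 0 < c ∧ ∀ (x : 𝔼) (r : ℝ), 0 < r → ∃ z, ball z (c * r) ⊆ ball x r ∧
      ∀ y ∈ ball z (c * r), ∀ ζ ∈ S, c * r ≤ |⟪ζ, y⟫| := by
  induction S using Finset.induction_on with
  | empty => exact ⟨1, one_pos, fun x r _ => ⟨x, by simp, by simp⟩⟩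
  | insert η S _ ih =>
    rw [Finset.mem_insert, not_or] at hS
    obtain ⟨c, hc, h⟩ := ih hS.2
    have hη : 0 < ‖η‖ := norm_pos_iff.2 (Ne.symm hS.1)
    set d : ℝ := min (1 / 4) (‖η‖ / 4)
    have hd : 0 < d := by positivity
    have hd4 : d ≤ 1 / 4 := min_le_left _ _
    have hdη : d ≤ ‖η‖ / 4 := min_le_right _ _
    refine ⟨c * d, by positivity, fun x r hr => ?_⟩
    obtain ⟨z, hz, hzS⟩ := h x r hr
    have hcr : 0 < c * r := by positivity
    obtain ⟨ε, hε, hεz⟩ : ∃ ε : ℝ, |ε| = 1 ∧ |⟪η, z⟫| = ε * ⟪η, z⟫ := by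
      rcases le_or_gt 0 ⟪η, z⟫ with h | h
      · exact ⟨1, by simp, by rw [abs_of_nonneg h, one_mul]⟩
      · exact ⟨-1, by simp, by rw [abs_of_neg h]; ring⟩
    have hε2 : ε * ε = 1 := by rw [← abs_mul_abs_self, hε, one_mul]
    set v : 𝔼 := (ε * (c * r / 2) * ‖η‖⁻¹) • η
    have hv : ‖v‖ = c * r / 2 := by
      rw [norm_smul, Real.norm_eq_abs, abs_mul, abs_mul, hε, abs_inv, abs_norm,
        abs_of_pos (by positivity : 0 < c * r / 2)]
      field_simp
    have hηv : ε * ⟪η, v⟫ = c * r / 2 * ‖η‖ := by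
      rw [inner_smul_right, real_inner_self_eq_norm_sq]
      field_simp
      rw [sq, hε2]
    have hsub : ball (z + v) (c * d * r) ⊆ ball z (c * r) := by
      apply ball_subset_ball'
      rw [dist_self_add_left, hv]
      nlinarith
    refine ⟨z + v, hsub.trans hz, fun y hy ζ hζ => ?_⟩
    rw [Finset.mem_insert] at hζ
    rcases hζ with rfl | hζ
    · have h1 : c * r / 2 * ‖ζ‖ ≤ |⟪ζ, z + v⟫| := by
        calc _ ≤ ε * ⟪ζ, z + v⟫ := by
              rw [inner_add_right, mul_add, ← hεz, hηv]
              exact le_add_of_nonneg_left (abs_nonneg _)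
          _ ≤ |ε * ⟪ζ, z + v⟫| := le_abs_self _
          _ = _ := by rw [abs_mul, hε, one_mul]
      have h2 : |⟪ζ, z + v⟫| ≤ |⟪ζ, y⟫| + ‖ζ‖ * (c * d * r) := by
        calc |⟪ζ, z + v⟫| = |⟪ζ, y⟫ + ⟪ζ, z + v - y⟫| := by rw [← inner_add_right]; simp
          _ ≤ |⟪ζ, y⟫| + |⟪ζ, z + v - y⟫| := abs_add_le _ _
          _ ≤ _ := by
            gcongr
            refine (abs_real_inner_le_norm _ _).trans ?_
            gcongr
            rw [mem_ball, dist_comm, dist_eq_norm] at hy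
            exact hy.le
      have h3 : ‖ζ‖ * (c * d * r) ≤ ‖ζ‖ * (c * r) / 4 := by
        have : 0 ≤ ‖ζ‖ * (c * r) := by positivity
        nlinarith
      have h4 : c * d * r ≤ (c * r) * (‖ζ‖ / 4) := by
        rw [mul_right_comm]; gcongr
      linarith
    · refine le_trans ?_ (hzS y (hsub hy) ζ hζ)
      nlinarith

lemma prod_abs_inner_rpow_le (S : Finset 𝔼) (k : 𝔼 → ℝ) (hk : ∀ ζ ∈ S, 0 ≤ k ζ)
    {c r Λ : ℝ} (hc : 0 < c) (hr : 0 < r) (hΛ : 0 ≤ Λ) {y z : 𝔼} (hyz : dist z y ≤ Λ * r)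
    (hy : ∀ ζ ∈ S, c * r ≤ |⟪ζ, y⟫|) :
    ∏ ζ ∈ S, |⟪ζ, z⟫| ^ (2 * k ζ) ≤
      (∏ ζ ∈ S, (1 + ‖ζ‖ * Λ / c) ^ (2 * k ζ)) * ∏ ζ ∈ S, |⟪ζ, y⟫| ^ (2 * k ζ) := by
  rw [← Finset.prod_mul_distrib]
  refine Finset.prod_le_prod (fun ζ _ => by positivity) fun ζ hζ => ?_
  rw [← Real.mul_rpow (by positivity) (by positivity)]
  refine Real.rpow_le_rpow (by positivity) ?_ (mul_nonneg zero_le_two (hk ζ hζ))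
  have h1 : |⟪ζ, z⟫| ≤ |⟪ζ, y⟫| + ‖ζ‖ * (Λ * r) := by
    calc |⟪ζ, z⟫| = |⟪ζ, y⟫ + ⟪ζ, z - y⟫| := by rw [← inner_add_right]; simp
      _ ≤ |⟪ζ, y⟫| + |⟪ζ, z - y⟫| := abs_add_le _ _
      _ ≤ _ := by
        gcongr
        refine (abs_real_inner_le_norm _ _).trans ?_
        gcongr
        rwa [← dist_eq_norm]
  have h2 : ‖ζ‖ * (Λ * r) ≤ ‖ζ‖ * Λ / c * |⟪ζ, y⟫| := by
    calc ‖ζ‖ * (Λ * r) = ‖ζ‖ * Λ / c * (c * r) := by field_simp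
      _ ≤ _ := by gcongr; exact hy ζ hζ
  linarith

/-- The measure with density `∏ |⟨ζ, x⟩| ^ (2 k(ζ))` is doubling. -/
theorem isBallDoubling_withDensity (S : Finset 𝔼) (hS : (0 : 𝔼) ∉ S)
    (k : 𝔼 → ℝ) (hk : ∀ ζ ∈ S, 0 ≤ k ζ) {w : 𝔼 → ℝ}
    (hw : ∀ x, w x = ∏ ζ ∈ S, |⟪ζ, x⟫| ^ (2 * k ζ)) :
    ∃ D : ℝ≥0, IsBallDoubling (volume.withDensity fun x => ENNReal.ofReal (w x)) D := by
  obtain ⟨c, hc, hball⟩ := exists_ball_away_from_hyperplanes S hS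
  set μ := (volume : Measure 𝔼).withDensity fun x => ENNReal.ofReal (w x)
  have hμball : ∀ x r, μ (ball x r) = ∫⁻ y in ball x r, ENNReal.ofReal (w y) :=
    fun x r => withDensity_apply _ measurableSet_ball
  have hwm : Measurable w := by
    rw [funext hw]
    fun_prop
  set C : ℝ := ∏ ζ ∈ S, (1 + ‖ζ‖ * 16 / c) ^ (2 * k ζ)
  have hC : 0 ≤ C := Finset.prod_nonneg fun ζ _ => by positivity
  have key : ∀ x r, 0 < r → ∃ z, ball z (c * r) ⊆ ball x r ∧ ∀ y ∈ ball z (c * r),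
      0 < w y ∧ μ (ball x (15 * r)) ≤ ENNReal.ofReal (C * w y) * volume (ball x (15 * r)) := by
    intro x r hr
    obtain ⟨z, hz, h⟩ := hball x r hr
    have hcr : 0 < c * r := by positivity
    refine ⟨z, hz, fun y hy => ⟨?_, ?_⟩⟩
    · rw [hw]
      exact Finset.prod_pos fun ζ hζ => Real.rpow_pos_of_pos (hcr.trans_le (h y hy ζ hζ)) _
    · rw [hμball, ← setLIntegral_const]
      refine setLIntegral_mono measurable_const fun v hv => ENNReal.ofReal_le_ofReal ?_
      rw [hw, hw]
      refine prod_abs_inner_rpow_le S k hk hc hr (by norm_num) ?_ (h y hy)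
      have hyx := hz hy
      rw [mem_ball] at hv hyx
      linarith [dist_triangle_right v y x]
  refine ⟨(C * (15 / c) ^ n).toNNReal, ⟨fun x r => ?_, fun x r hr => ?_, fun x r hr => ?_⟩⟩
  · rcases le_or_gt r 0 with hr | hr
    · simp [ball_eq_empty.2 hr]
    obtain ⟨z, -, h⟩ := key x r hr
    have h1 := (h z (mem_ball_self (by positivity))).2
    refine ne_top_of_le_ne_top (ENNReal.mul_ne_top ENNReal.ofReal_ne_top measure_ball_lt_top.ne)
      ((measure_mono (ball_subset_ball (by linarith))).trans h1)
  · obtain ⟨z, hz, h⟩ := key x r hr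
    refine fun h0 => ?_
    have h1 : μ (ball z (c * r)) = 0 := measure_mono_null hz h0
    rw [hμball] at h1
    refine ((setLIntegral_pos_iff hwm.ennreal_ofReal).2 ?_).ne' h1
    refine (measure_ball_pos volume z (by positivity : 0 < c * r)).trans_le (measure_mono ?_)
    exact fun y hy => ⟨(ENNReal.ofReal_pos.2 (h y hy).1).ne', hy⟩
  · obtain ⟨z, hz, h⟩ := key x r hr
    have hvol : volume (ball x (15 * r)) =
        ENNReal.ofReal ((15 / c) ^ n) * volume (ball z (c * r)) := by
      have e : 15 * r = 15 / c * (c * r) := by field_simp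
      rw [e, Measure.addHaar_ball_mul_of_pos _ _ (by positivity), finrank_euclideanSpace_fin,
        Measure.addHaar_ball_center _ z]
    set v := volume (ball z (c * r))
    have hv0 : v ≠ 0 := (measure_ball_pos _ _ (by positivity)).ne'
    have hvt : v ≠ ∞ := measure_ball_lt_top.ne
    have hint : v * μ (ball x (15 * r)) ≤
        ENNReal.ofReal C * volume (ball x (15 * r)) * μ (ball z (c * r)) := by
      rw [mul_comm v, ← setLIntegral_const, hμball z,
        ← lintegral_const_mul' _ _ (by finiteness)]
      refine setLIntegral_mono' measurableSet_ball fun y hy => ((h y hy).2).trans_eq ?_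
      rw [ENNReal.ofReal_mul hC]; ring
    rw [← ENNReal.mul_le_mul_iff_right hv0 hvt]
    refine hint.trans ?_
    rw [hvol, ← ENNReal.ofReal, ENNReal.ofReal_mul hC]
    calc _ = v * (ENNReal.ofReal C * ENNReal.ofReal ((15 / c) ^ n) * μ (ball z (c * r))) := by ring
      _ ≤ _ := by gcongr

end RootWeight

lemma lintegral_enorm_le_of_setAverage_le {X : Type*} [MeasurableSpace X] {μ : Measure X}
    {g : X → ℝ} {s : Set X} {C : ℝ} (hs0 : μ s ≠ 0) (hst : μ s ≠ ∞) (hg : IntegrableOn g s μ)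
    (h : ⨍ y in s, |g y| ∂μ ≤ C) : ∫⁻ y in s, ‖g y‖ₑ ∂μ ≤ ENNReal.ofReal C * μ s := by
  have hpos : 0 < μ.real s := ENNReal.toReal_pos hs0 hst
  rw [setAverage_eq, smul_eq_mul, inv_mul_le_iff₀ hpos] at h
  simp_rw [Real.enorm_eq_ofReal_abs]
  rw [← ofReal_integral_eq_lintegral_ofReal hg.abs
    (Filter.Eventually.of_forall fun _ => abs_nonneg _)]
  refine (ENNReal.ofReal_le_ofReal h).trans_eq ?_
  rw [ENNReal.ofReal_mul hpos.le, ofReal_measureReal hst, mul_comm]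

/-- For `f ∈ BMO(𝓛_k)` and `p ∈ [1, ∞)`, the maximal function `M_k f` is locally
`p`-integrable with respect to `ω_k`. -/
theorem maximal_locally_Lp
    (n : ℕ) (hn : 0 < n)
    (Rs Rp : Finset (EuclideanSpace ℝ (Fin n)))
    (hRs0 : (0 : EuclideanSpace ℝ (Fin n)) ∉ Rs)
    (hRsnorm : ∀ ζ ∈ Rs, ⟪ζ, ζ⟫ = (2 : ℝ))
    (hRsrefl : ∀ ζ ∈ Rs, ∀ η ∈ Rs, η - ⟪η, ζ⟫ • ζ ∈ Rs)
    (hRsline : ∀ ζ ∈ Rs, ∀ c : ℝ, c • ζ ∈ Rs → c = 1 ∨ c = -1)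
    (b : EuclideanSpace ℝ (Fin n))
    (hRpdef : ∀ ζ ∈ Rs, (ζ ∈ Rp ↔ 0 < ⟪ζ, b⟫)) (hRpsub : Rp ⊆ Rs)
    (k : EuclideanSpace ℝ (Fin n) → ℝ)
    (hk0 : ∀ ζ ∈ Rs, 0 ≤ k ζ)
    (hkinv : ∀ ζ ∈ Rs, ∀ η ∈ Rs, k (η - ⟪η, ζ⟫ • ζ) = k η)
    (w : EuclideanSpace ℝ (Fin n) → ℝ)
    (hw : ∀ x, w x = ∏ ζ ∈ Rp, |⟪ζ, x⟫| ^ (2 * k ζ))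
    (γ : ℝ) (hγ : γ = ∑ ζ ∈ Rp, k ζ)
    (μ : Measure (EuclideanSpace ℝ (Fin n)))
    (hμ : μ = volume.withDensity (fun x => ENNReal.ofReal (w x)))
    (V : EuclideanSpace ℝ (Fin n) → ℝ)
    (hV0 : ∀ x, 0 ≤ V x)
    (hVloc : LocallyIntegrable V μ)
    (hVne : ¬ (∀ᵐ x ∂μ, V x = 0))
    (q : ℝ) (hq : max 1 (((n : ℝ) + 2 * γ) / 2) < q)
    (C_RH : ℝ) (hC_RH : 0 < C_RH)
    (hRH : ∀ (x : EuclideanSpace ℝ (Fin n)) (r : ℝ), 0 < r →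
      (⨍ y in Metric.ball x r, V y ^ q ∂μ) ^ (1 / q) ≤
        C_RH * ⨍ y in Metric.ball x r, V y ∂μ)
    (ρ : EuclideanSpace ℝ (Fin n) → ℝ)
    (hρdef : ∀ x, ρ x = sSup {r : ℝ | 0 < r ∧
      r ^ 2 / (μ (Metric.ball x r)).toReal * ∫ y in Metric.ball x r, V y ∂μ ≤ 1})
    (hρpos : ∀ x, 0 < ρ x)
    (f : EuclideanSpace ℝ (Fin n) → ℝ) (hfloc : LocallyIntegrable f μ)
    (Cf : ℝ) (hCf0 : 0 ≤ Cf) (hCf : IsBMOL μ ρ f Cf)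
    (p : ℝ) (hp : 1 ≤ p) :
    ∀ (x₀ : EuclideanSpace ℝ (Fin n)) (r₀ : ℝ),
      ∫⁻ x in Metric.ball x₀ r₀, maximalFn μ f x ^ p ∂μ < ⊤ := by
  have hRp0 : (0 : EuclideanSpace ℝ (Fin n)) ∉ Rp := fun h => hRs0 (hRpsub h)
  obtain ⟨D, hD⟩ := isBallDoubling_withDensity Rp hRp0 k (fun ζ hζ => hk0 ζ (hRpsub hζ)) hw
  rw [← hμ] at hD
  have hf : AEMeasurable f μ := hfloc.aestronglyMeasurable.aemeasurable
  have hfball : ∀ x r, IntegrableOn f (ball x r) μ := fun x r =>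
    (hfloc.integrableOn_isCompact (isCompact_closedBall x r)).mono_set ball_subset_closedBall
  have hlarge : ∀ x r, ρ x ≤ r → ∫⁻ y in ball x r, ‖f y‖ₑ ∂μ ≤ Cf.toNNReal * μ (ball x r) :=
    fun x r hr => lintegral_enorm_le_of_setAverage_le (hD.ne_zero x r ((hρpos x).trans_le hr))
      (hD.ne_top x r) (hfball x r) (hCf.2 x r hr)
  have hm : HasOscBound μ f (fun x r => if r < ρ x then ⨍ z in ball x r, f z ∂μ else 0)
      Cf.toNNReal := by
    intro x r hr
    dsimp only
    split_ifs with h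
    · exact lintegral_enorm_le_of_setAverage_le (hD.ne_zero x r hr) (hD.ne_top x r)
        ((hfball x r).sub (integrableOn_const (hD.ne_top x r))) (hCf.1 x r hr h)
    · simpa using hlarge x r (not_lt.1 h)
  intro x₀ r₀
  rcases le_or_gt r₀ 0 with hr₀ | hr₀
  · simp [ball_eq_empty.2 hr₀]
  set I : ℝ≥0∞ := (∫⁻ y in ball x₀ (ρ x₀), ‖f y‖ₑ ∂μ) / μ (ball x₀ r₀)
  have h0 := hD.ne_zero x₀ r₀ hr₀
  have ht := hD.ne_top x₀ r₀
  have hIt : I ≠ ∞ := ENNReal.div_ne_top (hfball x₀ (ρ x₀)).2.ne h0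
  refine lintegral_maximalFn_rpow_lt_top hD hf hm (F := Cf.toNNReal + I.toNNReal)
    (fun s hs => ?_) (one_pos.trans_le hp)
  rw [ENNReal.coe_add, ENNReal.coe_toNNReal hIt, add_mul]
  rcases le_or_gt (ρ x₀) s with h | h
  · exact le_add_right (hlarge x₀ s h)
  · refine le_add_left ?_
    calc _ ≤ ∫⁻ y in ball x₀ (ρ x₀), ‖f y‖ₑ ∂μ := lintegral_mono_set (ball_subset_ball h.le)
      _ = I * μ (ball x₀ r₀) := (ENNReal.div_mul_cancel h0 ht).symm
      _ ≤ _ := by gcongr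
end
end

section
/- There exists a constant C > 0 such that for every f ∈ BMO(𝓛_k), every x₀ ∈ ℝ^n, and every r₀ ≥ ρ_k(x₀), the ball B = B(x₀,r₀) satisfies ω_k(B)^{-1} ∫_B M_k f dω_k ≤ C·‖f‖_{BMO(𝓛_k)}. -/
open MeasureTheory Metric Real
open scoped ENNReal RealInnerProductSpace

set_option linter.unusedVariables false

noncomputable section

open Set Filter Topology

section Doubling

variable {X : Type*} [PseudoMetricSpace X] [MeasurableSpace X]

/-- A measure on a metric space is doubling with constant `D` if balls have positive finite
measure and doubling the radius multiplies the measure by at most `D`. -/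
structure IsBallDoubling_s18 (μ : Measure X) (D : ℝ≥0∞) : Prop where
  ne_zero : ∀ (x : X) (r : ℝ), 0 < r → μ (ball x r) ≠ 0
  ne_top : ∀ (x : X) (r : ℝ), μ (ball x r) ≠ ∞
  two_mul_le : ∀ (x : X) (r : ℝ), 0 < r → μ (ball x (2 * r)) ≤ D * μ (ball x r)
  one_le : 1 ≤ D
  const_ne_top : D ≠ ∞

/-- The average of `g` over `ball z s`. -/
def ballAvg (μ : Measure X) (g : X → ℝ≥0∞) (z : X) (s : ℝ) : ℝ≥0∞ :=
  (μ (ball z s))⁻¹ * ∫⁻ x in ball z s, g x ∂μ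

/-- The maximal function of `g` restricted to balls of radius at most `r`. -/
def truncMaximalFn (μ : Measure X) (g : X → ℝ≥0∞) (r : ℝ) (x : X) : ℝ≥0∞ :=
  ⨆ (z : X) (s : ℝ) (_ : s ≤ r ∧ x ∈ ball z s), ballAvg μ g z s

theorem ballAvg_le_truncMaximalFn {μ : Measure X} {g : X → ℝ≥0∞} {r s : ℝ} {x z : X}
    (hs : s ≤ r) (hx : x ∈ ball z s) : ballAvg μ g z s ≤ truncMaximalFn μ g r x :=
  le_iSup_of_le z (le_iSup_of_le s (le_iSup_of_le ⟨hs, hx⟩ le_rfl))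

theorem truncMaximalFn_le {μ : Measure X} {g : X → ℝ≥0∞} {r : ℝ} {x : X} {c : ℝ≥0∞}
    (h : ∀ z s, s ≤ r → x ∈ ball z s → ballAvg μ g z s ≤ c) : truncMaximalFn μ g r x ≤ c :=
  iSup_le fun z => iSup_le fun s => iSup_le fun hs => h z s hs.1 hs.2

theorem ballAvg_mono {μ : Measure X} {g g' : X → ℝ≥0∞} (h : ∀ x, g x ≤ g' x) (z : X) (s : ℝ) :
    ballAvg μ g z s ≤ ballAvg μ g' z s :=
  mul_le_mul_right (lintegral_mono h) _

namespace IsBallDoubling_s18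

variable {μ : Measure X} {D : ℝ≥0∞} (hμ : IsBallDoubling_s18 μ D)
include hμ

theorem two_pow_mul_le (N : ℕ) {x : X} {r : ℝ} (hr : 0 < r) :
    μ (ball x (2 ^ N * r)) ≤ D ^ N * μ (ball x r) := by
  induction N with
  | zero => simp
  | succ N ih =>
    calc μ (ball x (2 ^ (N + 1) * r)) = μ (ball x (2 * (2 ^ N * r))) := by ring_nf
      _ ≤ D * μ (ball x (2 ^ N * r)) := hμ.two_mul_le x _ (by positivity)
      _ ≤ D * (D ^ N * μ (ball x r)) := by gcongr
      _ = D ^ (N + 1) * μ (ball x r) := by ring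

theorem measure_le_of_dist_add_le (N : ℕ) {x y : X} {r t : ℝ} (hr : 0 < r)
    (h : t + dist y x ≤ 2 ^ N * r) : μ (ball y t) ≤ D ^ N * μ (ball x r) :=
  (measure_mono (ball_subset_ball' h)).trans (hμ.two_pow_mul_le N hr)

theorem ballAvg_mul_measure (g : X → ℝ≥0∞) (z : X) {s : ℝ} (hs : 0 < s) :
    ballAvg μ g z s * μ (ball z s) = ∫⁻ x in ball z s, g x ∂μ := by
  rw [ballAvg, mul_right_comm, ENNReal.inv_mul_cancel (hμ.ne_zero z s hs) (hμ.ne_top z s), one_mul]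

theorem ballAvg_le_iff {g : X → ℝ≥0∞} {z : X} {s : ℝ} (hs : 0 < s) {c : ℝ≥0∞} :
    ballAvg μ g z s ≤ c ↔ ∫⁻ x in ball z s, g x ∂μ ≤ c * μ (ball z s) := by
  rw [← hμ.ballAvg_mul_measure g z hs,
    ENNReal.mul_le_mul_iff_left (hμ.ne_zero z s hs) (hμ.ne_top z s)]

theorem ballAvg_le_of_le_add [OpensMeasurableSpace X] {g h : X → ℝ≥0∞} {a : ℝ≥0∞} {z : X} {s : ℝ}
    (hs : 0 < s) (hg : ∀ x ∈ ball z s, g x ≤ a + h x) :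
    ballAvg μ g z s ≤ a + ballAvg μ h z s := by
  rw [hμ.ballAvg_le_iff hs, add_mul, hμ.ballAvg_mul_measure h z hs]
  refine (setLIntegral_mono' measurableSet_ball hg).trans ?_
  rw [lintegral_add_left measurable_const, setLIntegral_const]

theorem ballAvg_le_of_le [OpensMeasurableSpace X] {g : X → ℝ≥0∞} {a : ℝ≥0∞} {z : X} {s : ℝ}
    (hs : 0 < s) (hg : ∀ x ∈ ball z s, g x ≤ a) : ballAvg μ g z s ≤ a := by
  rw [hμ.ballAvg_le_iff hs, ← setLIntegral_const]
  exact setLIntegral_mono' measurableSet_ball hg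

/-- Averages over nested comparable balls are comparable. -/
theorem ballAvg_le_pow_mul (g : X → ℝ≥0∞) (N : ℕ) {x y : X} {t R : ℝ} (ht : 0 < t) (hR : 0 < R)
    (hsub : t + dist y x ≤ R) (h : R + dist y x ≤ 2 ^ N * t) :
    ballAvg μ g y t ≤ D ^ N * ballAvg μ g x R := by
  rw [hμ.ballAvg_le_iff ht]
  calc ∫⁻ x in ball y t, g x ∂μ ≤ ∫⁻ x in ball x R, g x ∂μ :=
        lintegral_mono_set (ball_subset_ball' hsub)
    _ = ballAvg μ g x R * μ (ball x R) := (hμ.ballAvg_mul_measure g x hR).symm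
    _ ≤ ballAvg μ g x R * (D ^ N * μ (ball y t)) := by
        gcongr
        exact hμ.measure_le_of_dist_add_le N ht (by rwa [dist_comm])
    _ = D ^ N * ballAvg μ g x R * μ (ball y t) := by ring

omit hμ in
/-- A Calderón–Zygmund type covering: the points of `ball x r` lying in a ball on which `h` has
average exceeding `c` are covered by the five-fold dilates of countably many disjoint such balls,
each of which is almost of maximal radius around one of the points of `ball x r` it contains. -/
theorem exists_stopping_balls [OpensMeasurableSpace X] [SecondCountableTopology X]
    (h : X → ℝ≥0∞) (c : ℝ≥0∞) (x : X) (r R : ℝ)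
    (hR : ∀ y ∈ ball x r, ∀ z s, y ∈ ball z s → c < ballAvg μ h z s → s ≤ R) :
    ∃ (u : Set X) (z : X → X) (s : X → ℝ), u.Countable ∧
      (u.PairwiseDisjoint fun y => ball (z y) (s y)) ∧
      (∀ y ∈ u, y ∈ ball x r ∧ y ∈ ball (z y) (s y) ∧ s y ≤ R ∧
        c < ballAvg μ h (z y) (s y) ∧
        ∀ z' t, y ∈ ball z' t → 2 * s y ≤ t → ballAvg μ h z' t ≤ c) ∧
      ∀ y ∈ ball x r, (∃ z' t, y ∈ ball z' t ∧ c < ballAvg μ h z' t) →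
        ∃ v ∈ u, y ∈ ball (z v) (5 * s v) := by
  set T : Set X := {y | y ∈ ball x r ∧ ∃ z' t, y ∈ ball z' t ∧ c < ballAvg μ h z' t}
  have key : ∀ y, ∃ (z : X) (s : ℝ), y ∈ T → y ∈ ball z s ∧ c < ballAvg μ h z s ∧
      ∀ z' t, y ∈ ball z' t → 2 * s ≤ t → ballAvg μ h z' t ≤ c := by
    intro y
    by_cases hy : y ∈ T
    · obtain ⟨hyB, z₀, s₀, hz₀, hs₀⟩ := hy
      set S : Set ℝ := {t | ∃ z', y ∈ ball z' t ∧ c < ballAvg μ h z' t}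
      have hbdd : BddAbove S := ⟨R, fun t ⟨z', hz', ht⟩ => hR y hyB z' t hz' ht⟩
      have hmem : s₀ ∈ S := ⟨z₀, hz₀, hs₀⟩
      have hpos : 0 < sSup S := (pos_of_mem_ball hz₀).trans_le (le_csSup hbdd hmem)
      obtain ⟨s, ⟨z, hz, hs⟩, hlt⟩ := exists_lt_of_lt_csSup ⟨s₀, hmem⟩ (half_lt_self hpos)
      refine ⟨z, s, fun _ => ⟨hz, hs, fun z' t hz' ht => ?_⟩⟩
      by_contra! hc
      have : t ≤ sSup S := le_csSup hbdd ⟨z', hz', hc⟩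
      linarith
    · exact ⟨y, 0, fun h => absurd h hy⟩
  choose z s hzs using key
  obtain ⟨u, huT, hdisj, hcov⟩ := Vitali.exists_disjoint_subfamily_covering_enlargement_closedBall
    T z s R (fun y hy => hR y hy.1 _ _ (hzs y hy).1 (hzs y hy).2.1) 4 (by norm_num)
  have hdisj' : u.PairwiseDisjoint fun y => ball (z y) (s y) :=
    hdisj.mono fun y => ball_subset_closedBall
  refine ⟨u, z, s, ?_, hdisj', fun y hy => ?_, fun y hy hex => ?_⟩
  · exact hdisj'.countable_of_isOpen (fun _ _ => isOpen_ball)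
      fun y hy => ⟨y, (hzs y (huT hy)).1⟩
  · have := hzs y (huT hy)
    exact ⟨(huT hy).1, this.1, hR y (huT hy).1 _ _ this.1 this.2.1, this.2⟩
  · have hyT : y ∈ T := ⟨hy, hex⟩
    obtain ⟨v, hv, hsub⟩ := hcov y hyT
    refine ⟨v, hv, ?_⟩
    have h1 := hsub (ball_subset_closedBall (hzs y hyT).1)
    have h2 := pos_of_mem_ball (hzs v (huT hv)).1
    exact closedBall_subset_ball (by linarith) h1

theorem le_of_lt_ballAvg {h : X → ℝ≥0∞} {A : ℝ≥0∞} (hA0 : A ≠ 0) (hA : A ≠ ∞) {x : X} {r : ℝ}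
    (hr : 0 < r) (hh : ∫⁻ y, h y ∂μ ≤ A * μ (ball x (3 * r)))
    {y z : X} {s : ℝ} (hy : y ∈ ball x r) (hyz : y ∈ ball z s)
    (hc : D ^ 6 * A < ballAvg μ h z s) : s ≤ r / 8 := by
  by_contra! hs
  have hs0 : 0 < s := by linarith
  refine hc.not_ge ((hμ.ballAvg_le_iff hs0).2 ?_)
  calc ∫⁻ x in ball z s, h x ∂μ ≤ ∫⁻ x, h x ∂μ := setLIntegral_le_lintegral _ _
    _ ≤ A * μ (ball x (3 * r)) := hh
    _ ≤ A * (D ^ 6 * μ (ball z s)) := by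
        gcongr
        refine hμ.measure_le_of_dist_add_le 6 hs0 ?_
        have := dist_triangle_left x z y
        rw [mem_ball] at hy hyz
        linarith
    _ = _ := by ring

/-- One step of the self-improving estimate for the truncated maximal function of a function of
bounded mean oscillation. -/
theorem lintegral_truncMaximalFn_step [OpensMeasurableSpace X] [SecondCountableTopology X]
    {g : X → ℝ≥0∞} {A : ℝ≥0∞} (hA0 : A ≠ 0) (hA : A ≠ ∞)
    (hg : ∀ z s, 0 < s → ∫⁻ x in ball z s, (g x - ballAvg μ g z s) ∂μ ≤ A * μ (ball z s))
    {Φ : ℝ≥0∞}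
    (hΦ : ∀ z s, 0 < s →
      ∫⁻ x in ball z s, (truncMaximalFn μ g s x - ballAvg μ g z (3 * s)) ∂μ ≤ Φ * μ (ball z s))
    (x : X) {r : ℝ} (hr : 0 < r) :
    ∫⁻ y in ball x r, (truncMaximalFn μ g r y - ballAvg μ g x (3 * r)) ∂μ ≤
      (Φ / 2 + 2 * D ^ 6 * (2 + D ^ 2) * A) * μ (ball x r) := by
  set a := ballAvg μ g x (3 * r)
  set h : X → ℝ≥0∞ := (ball x (3 * r)).indicator fun y => g y - a with hh
  set c := 2 * D ^ 6 * A with hc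
  have hle : D ^ 6 * A ≤ c := by
    rw [hc, mul_assoc]
    exact le_mul_of_one_le_left' (by norm_num)
  have h_integral : ∫⁻ y, h y ∂μ ≤ A * μ (ball x (3 * r)) := by
    rw [hh, lintegral_indicator measurableSet_ball]
    exact hg x _ (by positivity)
  have hgh : ∀ y ∈ ball x (3 * r), g y ≤ a + h y := by
    intro y hy
    rw [hh, indicator_of_mem hy]
    exact le_add_tsub
  obtain ⟨u, z, s, hu, hdisj, hprop, hcov⟩ := exists_stopping_balls h c x r (r / 8)
    fun y hy z s hyz hlt => hμ.le_of_lt_ballAvg hA0 hA hr h_integral hy hyz (hle.trans_lt hlt)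
  have hsmall : ∑' v : u, μ (ball (z v) (5 * s v)) ≤ μ (ball x r) / 2 := by
    have h1 : c * ∑' v : u, μ (ball (z v) (s v)) ≤ A * (D ^ 2 * μ (ball x r)) := by
      rw [← ENNReal.tsum_mul_left]
      calc ∑' v : u, c * μ (ball (z v) (s v))
          ≤ ∑' v : u, ∫⁻ y in ball (z v) (s v), h y ∂μ := by
            refine ENNReal.tsum_le_tsum fun v => ?_
            have hv := hprop v v.2
            rw [← hμ.ballAvg_mul_measure h _ (pos_of_mem_ball hv.2.1)]
            gcongr
            exact hv.2.2.2.1.le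
        _ = ∫⁻ y in ⋃ v ∈ u, ball (z v) (s v), h y ∂μ :=
            (lintegral_biUnion hu (fun _ _ => measurableSet_ball) hdisj _).symm
        _ ≤ ∫⁻ y, h y ∂μ := setLIntegral_le_lintegral _ _
        _ ≤ A * μ (ball x (3 * r)) := h_integral
        _ ≤ A * (D ^ 2 * μ (ball x r)) := by
            gcongr
            exact hμ.measure_le_of_dist_add_le 2 hr (by rw [dist_self]; linarith)
    have h2 : ∑' v : u, μ (ball (z v) (5 * s v)) ≤ D ^ 3 * ∑' v : u, μ (ball (z v) (s v)) := by
      rw [← ENNReal.tsum_mul_left]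
      refine ENNReal.tsum_le_tsum fun v => ?_
      have hs := pos_of_mem_ball (hprop v v.2).2.1
      exact hμ.measure_le_of_dist_add_le 3 hs (by rw [dist_self]; linarith)
    have hD0 : D ≠ 0 := (zero_lt_one.trans_le hμ.one_le).ne'
    rw [ENNReal.le_div_iff_mul_le (by simp) (by simp), mul_comm,
      ← ENNReal.mul_le_mul_iff_right (a := D ^ 3 * A) (mul_ne_zero (pow_ne_zero _ hD0) hA0)
        (ENNReal.mul_ne_top (ENNReal.pow_ne_top hμ.const_ne_top) hA)]
    calc D ^ 3 * A * (2 * ∑' v : u, μ (ball (z v) (5 * s v)))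
        ≤ D ^ 3 * A * (2 * (D ^ 3 * ∑' v : u, μ (ball (z v) (s v)))) := by gcongr
      _ = c * ∑' v : u, μ (ball (z v) (s v)) := by rw [hc]; ring
      _ ≤ A * (D ^ 2 * μ (ball x r)) := h1
      _ ≤ A * (D ^ 3 * μ (ball x r)) := by
          gcongr
          · exact hμ.one_le
          · norm_num
      _ = D ^ 3 * A * μ (ball x r) := by ring
  set U : Set X := ⋃ v : u, (ball x r ∩ ball (z v) (5 * s v))
  have hgood : ∀ y ∈ ball x r \ U, truncMaximalFn μ g r y - a ≤ c := by
    rintro y ⟨hy, hyU⟩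
    rw [tsub_le_iff_left]
    refine truncMaximalFn_le fun z' t ht hyt => ?_
    have ht0 := pos_of_mem_ball hyt
    refine (hμ.ballAvg_le_of_le_add ht0 fun w hw => hgh w ?_).trans (add_le_add_right ?_ a)
    · rw [mem_ball] at hw hy hyt ⊢
      have h1 := dist_triangle w z' x
      have h2 := dist_triangle_left z' x y
      linarith
    · by_contra! hlt
      obtain ⟨v, hv, hyv⟩ := hcov y hy ⟨z', t, hyt, hlt⟩
      exact hyU (mem_iUnion.2 ⟨⟨v, hv⟩, hy, hyv⟩)
  have hbad : ∀ v ∈ u, ∀ y ∈ ball x r ∩ ball (z v) (5 * s v),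
      truncMaximalFn μ g r y - a ≤
        (truncMaximalFn μ g (5 * s v) y - ballAvg μ g (z v) (3 * (5 * s v))) + (1 + D ^ 2) * c := by
    rintro v hv y ⟨hy, hyv⟩
    obtain ⟨hvx, hvz, hvr, -, hmax⟩ := hprop v hv
    have hs := pos_of_mem_ball hvz
    rw [mem_ball] at hy hyv hvx hvz
    rw [tsub_le_iff_left]
    refine truncMaximalFn_le fun z' t ht hyt => ?_
    have ht0 := pos_of_mem_ball hyt
    rcases le_or_gt t (5 * s v) with htv | htv
    · have h1 : ballAvg μ g (z v) (3 * (5 * s v)) ≤ a + c := by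
        refine (hμ.ballAvg_le_of_le_add (by positivity) fun w hw => hgh w ?_).trans
          (add_le_add_right (hmax _ _ ?_ (by linarith)) a)
        · rw [mem_ball] at hw ⊢
          have h1 := dist_triangle w (z v) x
          have h2 := dist_triangle_left (z v) x v
          linarith
        · rw [mem_ball]; linarith
      calc ballAvg μ g z' t ≤ truncMaximalFn μ g (5 * s v) y := ballAvg_le_truncMaximalFn htv hyt
        _ ≤ ballAvg μ g (z v) (3 * (5 * s v)) +
            (truncMaximalFn μ g (5 * s v) y - ballAvg μ g (z v) (3 * (5 * s v))) := le_add_tsub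
        _ ≤ (a + c) +
            (truncMaximalFn μ g (5 * s v) y - ballAvg μ g (z v) (3 * (5 * s v))) := by gcongr
        _ = a + ((truncMaximalFn μ g (5 * s v) y - ballAvg μ g (z v) (3 * (5 * s v))) + 1 * c) := by
            ring
        _ ≤ _ := by gcongr; exact le_self_add
    · rw [mem_ball] at hyt
      have h1 : ballAvg μ h z' t ≤ D ^ 2 * c := by
        refine (hμ.ballAvg_le_pow_mul h 2 (x := z') (R := t + 6 * s v) ht0 (by positivity)
          (by rw [dist_self]; linarith) (by rw [dist_self]; linarith)).trans ?_
        gcongr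
        refine hmax _ _ ?_ (by linarith)
        rw [mem_ball]
        have h1 := dist_triangle v (z v) z'
        have h2 := dist_triangle_left (z v) z' y
        linarith
      calc ballAvg μ g z' t ≤ a + ballAvg μ h z' t := by
            refine hμ.ballAvg_le_of_le_add ht0 fun w hw => hgh w ?_
            rw [mem_ball] at hw ⊢
            have h1 := dist_triangle w z' x
            have h2 := dist_triangle_left z' x y
            linarith
        _ ≤ a + (0 + (0 + D ^ 2) * c) := by rw [zero_add, zero_add]; gcongr
        _ ≤ _ := by gcongr <;> exact zero_le
  have hucount : Countable u := hu.to_subtype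
  calc ∫⁻ y in ball x r, (truncMaximalFn μ g r y - a) ∂μ
      ≤ ∫⁻ y in (ball x r \ U) ∪ U, (truncMaximalFn μ g r y - a) ∂μ :=
        lintegral_mono_set (by rw [sdiff_union_self]; exact subset_union_left)
    _ ≤ ∫⁻ y in ball x r \ U, (truncMaximalFn μ g r y - a) ∂μ +
          ∫⁻ y in U, (truncMaximalFn μ g r y - a) ∂μ := lintegral_union_le _ _ _
    _ ≤ c * μ (ball x r) + (Φ + (1 + D ^ 2) * c) * (μ (ball x r) / 2) := by
        gcongr
        · calc ∫⁻ y in ball x r \ U, (truncMaximalFn μ g r y - a) ∂μ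
              ≤ ∫⁻ _ in ball x r \ U, c ∂μ :=
                setLIntegral_mono' (measurableSet_ball.diff <| MeasurableSet.iUnion fun _ =>
                  measurableSet_ball.inter measurableSet_ball) hgood
            _ ≤ ∫⁻ _ in ball x r, c ∂μ := lintegral_mono_set sdiff_subset
            _ = c * μ (ball x r) := setLIntegral_const _ _
        · calc ∫⁻ y in U, (truncMaximalFn μ g r y - a) ∂μ
              ≤ ∑' v : u, ∫⁻ y in ball x r ∩ ball (z v) (5 * s v),
                  (truncMaximalFn μ g r y - a) ∂μ := lintegral_iUnion_le _ _
            _ ≤ ∑' v : u, (Φ + (1 + D ^ 2) * c) * μ (ball (z v) (5 * s v)) := by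
                refine ENNReal.tsum_le_tsum fun v => ?_
                have hs := pos_of_mem_ball (hprop v v.2).2.1
                refine (setLIntegral_mono' (measurableSet_ball.inter measurableSet_ball)
                  (hbad v v.2)).trans ((lintegral_mono_set inter_subset_right).trans ?_)
                rw [lintegral_add_right _ measurable_const, setLIntegral_const, add_mul Φ]
                exact add_le_add_left (hΦ (z v) (5 * s v) (by positivity)) _
            _ = (Φ + (1 + D ^ 2) * c) * ∑' v : u, μ (ball (z v) (5 * s v)) :=
                ENNReal.tsum_mul_left
            _ ≤ (Φ + (1 + D ^ 2) * c) * (μ (ball x r) / 2) := by gcongr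
    _ ≤ c * μ (ball x r) + (Φ / 2 * μ (ball x r) + (1 + D ^ 2) * c * μ (ball x r)) := by
        rw [add_mul Φ]
        refine add_le_add_right (add_le_add (le_of_eq ?_) ?_) _
        · rw [ENNReal.div_eq_inv_mul, ENNReal.div_eq_inv_mul]
          ring
        · gcongr
          exact ENNReal.half_le_self
    _ = _ := by rw [hc]; ring

theorem lintegral_truncMaximalFn_le [OpensMeasurableSpace X] [SecondCountableTopology X]
    {g : X → ℝ≥0∞} {A m : ℝ≥0∞} (hA0 : A ≠ 0) (hA : A ≠ ∞) (hm : m ≠ ∞) (hgm : ∀ x, g x ≤ m)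
    (hg : ∀ z s, 0 < s → ∫⁻ x in ball z s, (g x - ballAvg μ g z s) ∂μ ≤ A * μ (ball z s))
    (x : X) {r : ℝ} (hr : 0 < r) :
    ∫⁻ y in ball x r, (truncMaximalFn μ g r y - ballAvg μ g x (3 * r)) ∂μ ≤
      4 * D ^ 6 * (2 + D ^ 2) * A * μ (ball x r) := by
  set F : X → ℝ → ℝ≥0∞ := fun z s =>
    ballAvg μ (fun y => truncMaximalFn μ g s y - ballAvg μ g z (3 * s)) z s
  set Φ : ℝ≥0∞ := ⨆ (z : X) (s : ℝ) (_ : 0 < s), F z s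
  have hle : ∀ z s, 0 < s →
      ∫⁻ x in ball z s, (truncMaximalFn μ g s x - ballAvg μ g z (3 * s)) ∂μ ≤
        Φ * μ (ball z s) := fun z s hs =>
    (hμ.ballAvg_le_iff hs).1 (le_iSup_of_le z (le_iSup_of_le s (le_iSup_of_le hs le_rfl)))
  have hfin : Φ ≤ m := iSup_le fun z => iSup_le fun s => iSup_le fun hs =>
    hμ.ballAvg_le_of_le hs fun y _ => tsub_le_self.trans <|
      truncMaximalFn_le fun z' t _ hyt => hμ.ballAvg_le_of_le (pos_of_mem_ball hyt) fun w _ => hgm w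
  have hstep : Φ ≤ Φ / 2 + 2 * D ^ 6 * (2 + D ^ 2) * A :=
    iSup_le fun z => iSup_le fun s => iSup_le fun hs =>
      (hμ.ballAvg_le_iff hs).2 (hμ.lintegral_truncMaximalFn_step hA0 hA hg hle z hs)
  have hhalf : Φ / 2 ≤ 2 * D ^ 6 * (2 + D ^ 2) * A := by
    refine ENNReal.le_of_add_le_add_left (a := Φ / 2) ?_ (by rwa [ENNReal.add_halves])
    exact (ENNReal.half_le_self.trans_lt (hfin.trans_lt hm.lt_top)).ne
  refine (hle x r hr).trans ?_
  gcongr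
  calc Φ = Φ / 2 + Φ / 2 := (ENNReal.add_halves Φ).symm
    _ ≤ 2 * D ^ 6 * (2 + D ^ 2) * A + 2 * D ^ 6 * (2 + D ^ 2) * A := by gcongr
    _ = _ := by ring

/-- A ball of radius exceeding `r` which meets `ball x r` has average bounded by averages over
balls centred at `x`. -/
theorem ballAvg_le_of_large {g : X → ℝ≥0∞} {x y z : X} {r t : ℝ} (hrt : r < t)
    (hy : y ∈ ball x r) (hyz : y ∈ ball z t) :
    ballAvg μ g z t ≤ D ^ 3 * ballAvg μ g x (3 * t) := by
  have ht := pos_of_mem_ball hyz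
  have h1 := dist_triangle_left z x y
  rw [mem_ball] at hy hyz
  exact hμ.ballAvg_le_pow_mul g 3 ht (by positivity) (by linarith) (by linarith)

/-- For a bounded function of bounded mean oscillation whose averages over all balls
`ball x R`, `R ≥ r`, are bounded, the maximal function has bounded average on `ball x r`. -/
theorem lintegral_iSup_ballAvg_le [OpensMeasurableSpace X] [SecondCountableTopology X]
    {g : X → ℝ≥0∞} {A m : ℝ≥0∞} (hA0 : A ≠ 0) (hA : A ≠ ∞) (hm : m ≠ ∞) (hgm : ∀ x, g x ≤ m)
    (hg : ∀ z s, 0 < s → ∫⁻ x in ball z s, (g x - ballAvg μ g z s) ∂μ ≤ A * μ (ball z s))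
    (x : X) {r : ℝ} (hr : 0 < r) (hx : ∀ R, r ≤ R → ballAvg μ g x R ≤ A) :
    ∫⁻ y in ball x r, (⨆ (z : X) (s : ℝ) (_ : y ∈ ball z s), ballAvg μ g z s) ∂μ ≤
      (1 + D ^ 3 + 4 * D ^ 6 * (2 + D ^ 2)) * A * μ (ball x r) := by
  calc ∫⁻ y in ball x r, (⨆ (z : X) (s : ℝ) (_ : y ∈ ball z s), ballAvg μ g z s) ∂μ
      ≤ ∫⁻ y in ball x r,
          ((1 + D ^ 3) * A + (truncMaximalFn μ g r y - ballAvg μ g x (3 * r))) ∂μ := by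
        refine setLIntegral_mono' measurableSet_ball fun y hy => ?_
        refine iSup_le fun z => iSup_le fun s => iSup_le fun hyz => ?_
        rcases le_or_gt s r with hs | hs
        · calc ballAvg μ g z s ≤ truncMaximalFn μ g r y := ballAvg_le_truncMaximalFn hs hyz
            _ ≤ ballAvg μ g x (3 * r) + (truncMaximalFn μ g r y - ballAvg μ g x (3 * r)) :=
              le_add_tsub
            _ ≤ (1 + D ^ 3) * A + (truncMaximalFn μ g r y - ballAvg μ g x (3 * r)) := by
              refine add_le_add_left ((hx _ (by linarith)).trans ?_) _
              exact le_mul_of_one_le_left' le_self_add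
        · calc ballAvg μ g z s ≤ D ^ 3 * ballAvg μ g x (3 * s) := hμ.ballAvg_le_of_large hs hy hyz
            _ ≤ D ^ 3 * A := by
              gcongr
              exact hx _ (by linarith)
            _ ≤ (1 + D ^ 3) * A := by
              gcongr
              exact le_add_self
            _ ≤ _ := le_self_add
    _ ≤ (1 + D ^ 3) * A * μ (ball x r) + 4 * D ^ 6 * (2 + D ^ 2) * A * μ (ball x r) := by
        rw [lintegral_add_left measurable_const, setLIntegral_const]
        gcongr
        exact hμ.lintegral_truncMaximalFn_le hA0 hA hm hgm hg x hr
    _ = _ := by ring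

/-- Truncation preserves bounded mean oscillation. -/
theorem lintegral_min_sub_ballAvg_le [OpensMeasurableSpace X] {f : X → ℝ} {A : ℝ≥0∞} {z : X}
    {s : ℝ} (hs : 0 < s) {c : ℝ}
    (hfm : AEMeasurable f (μ.restrict (ball z s)))
    (hf : ∫⁻ x in ball z s, ENNReal.ofReal |f x - c| ∂μ ≤ A * μ (ball z s)) (m : ℝ≥0∞) :
    ∫⁻ x in ball z s, (min (ENNReal.ofReal |f x|) m -
        ballAvg μ (fun y => min (ENNReal.ofReal |f y|) m) z s) ∂μ ≤ 2 * A * μ (ball z s) := by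
  have habs : ∀ a b : ℝ, min (ENNReal.ofReal |a|) m ≤
      min (ENNReal.ofReal |b|) m + ENNReal.ofReal |a - b| := by
    intro a b
    rw [min_add]
    refine le_min ((min_le_left _ _).trans ?_) ((min_le_right _ _).trans le_self_add)
    rw [← ENNReal.ofReal_add (abs_nonneg _) (abs_nonneg _)]
    refine ENNReal.ofReal_le_ofReal ?_
    have := abs_add_le b (a - b)
    rwa [add_sub_cancel] at this
  set g : X → ℝ≥0∞ := fun y => min (ENNReal.ofReal |f y|) m with hg
  have hc : min (ENNReal.ofReal |c|) m ≤ ballAvg μ g z s + A := by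
    rw [← ENNReal.mul_le_mul_iff_left (hμ.ne_zero z s hs) (hμ.ne_top z s), add_mul,
      hμ.ballAvg_mul_measure g z hs, ← setLIntegral_const]
    refine (setLIntegral_mono' measurableSet_ball fun x _ => habs c (f x)).trans ?_
    have hmeas : AEMeasurable (fun x => ENNReal.ofReal |c - f x|) (μ.restrict (ball z s)) := by
      fun_prop
    rw [lintegral_add_right' _ hmeas]
    simp_rw [abs_sub_comm c]
    gcongr
  calc ∫⁻ x in ball z s, (g x - ballAvg μ g z s) ∂μ
      ≤ ∫⁻ x in ball z s, (A + ENNReal.ofReal |f x - c|) ∂μ := by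
        refine lintegral_mono fun x => ?_
        rw [tsub_le_iff_left, ← add_assoc]
        exact (habs (f x) c).trans (add_le_add_left hc _)
    _ ≤ A * μ (ball z s) + A * μ (ball z s) := by
        rw [lintegral_add_left measurable_const, setLIntegral_const]
        gcongr
    _ = _ := by ring

end IsBallDoubling_s18

theorem measurable_iSup_ballAvg [OpensMeasurableSpace X] (μ : Measure X) (g : X → ℝ≥0∞) :
    Measurable fun y => ⨆ (z : X) (s : ℝ) (_ : y ∈ ball z s), ballAvg μ g z s := by
  refine LowerSemicontinuous.measurable fun y c hc => ?_
  simp only [lt_iSup_iff] at hc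
  obtain ⟨z, s, hy, hlt⟩ := hc
  filter_upwards [isOpen_ball.mem_nhds hy] with y' hy'
  exact hlt.trans_le (le_iSup_of_le z (le_iSup_of_le s (le_iSup_of_le hy' le_rfl)))

theorem maximalFn_eq_iSup_min [OpensMeasurableSpace X] {μ : Measure X} {f : X → ℝ}
    (hfm : AEMeasurable f μ) (x : X) :
    maximalFn μ f x = ⨆ m : ℕ, ⨆ (z : X) (s : ℝ) (_ : x ∈ ball z s),
      ballAvg μ (fun y => min (ENNReal.ofReal |f y|) m) z s := by
  have hlim : ∀ (z : X) (s : ℝ), (μ (ball z s))⁻¹ * ∫⁻ y in ball z s, ENNReal.ofReal |f y| ∂μ =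
      ⨆ m : ℕ, ballAvg μ (fun y => min (ENNReal.ofReal |f y|) m) z s := by
    intro z s
    simp_rw [ballAvg, ← ENNReal.mul_iSup]
    rw [← lintegral_iSup']
    · congr 2 with y
      rw [← inf_iSup_eq, ENNReal.iSup_natCast, inf_top_eq]
    · intro m
      have := hfm.restrict (s := ball z s)
      fun_prop
    · exact ae_of_all _ fun y i j hij => min_le_min le_rfl (by exact_mod_cast hij)
  simp_rw [maximalFn, hlim]
  apply le_antisymm
  · exact iSup_le fun z => iSup_le fun s => iSup_le fun hx => iSup_mono fun m =>
      le_iSup_of_le z (le_iSup_of_le s (le_iSup_of_le hx le_rfl))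
  · exact iSup_le fun m => iSup_mono fun z => iSup_mono fun s => iSup_mono fun _ =>
      le_iSup (fun m : ℕ => ballAvg μ (fun y => min (ENNReal.ofReal |f y|) m) z s) m

/-- On a doubling space, the average over a large ball of the maximal function of a function in
the critical-radius `BMO` space is controlled by the `BMO` constant. -/
theorem IsBMOL.lintegral_maximalFn_le [OpensMeasurableSpace X] [SecondCountableTopology X]
    [ProperSpace X] {μ : Measure X} {D : ℝ≥0∞} (hμ : IsBallDoubling_s18 μ D) {ρ : X → ℝ}
    {f : X → ℝ} (hf : LocallyIntegrable f μ) {A : ℝ} (hA : 0 < A) (hbmo : IsBMOL μ ρ f A)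
    {x : X} {r : ℝ} (hr : 0 < r) (hρ : ρ x ≤ r) :
    ∫⁻ y in ball x r, maximalFn μ f y ∂μ ≤
      (1 + D ^ 3 + 4 * D ^ 6 * (2 + D ^ 2)) * (2 * ENNReal.ofReal A) * μ (ball x r) := by
  have hfm : AEMeasurable f μ := hf.aestronglyMeasurable.aemeasurable
  have h_integral : ∀ z s, IntegrableOn f (ball z s) μ := fun z s =>
    (hf.integrableOn_isCompact (isCompact_closedBall z s)).mono_set ball_subset_closedBall
  have hconv : ∀ (z : X) (s c : ℝ), 0 < s → ⨍ y in ball z s, |f y - c| ∂μ ≤ A →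
      ∫⁻ y in ball z s, ENNReal.ofReal |f y - c| ∂μ ≤ ENNReal.ofReal A * μ (ball z s) := by
    intro z s c hs h
    have hfc : IntegrableOn (fun y => |f y - c|) (ball z s) μ :=
      ((h_integral z s).sub (integrableOn_const (hμ.ne_top z s))).abs
    have h' := ENNReal.ofReal_le_ofReal h
    rwa [ofReal_setAverage hfc (ae_of_all _ fun _ => abs_nonneg _),
      ENNReal.div_le_iff (hμ.ne_zero z s hs) (hμ.ne_top z s)] at h'
  have hosc : ∀ z s, 0 < s → ∃ c : ℝ,
      ∫⁻ y in ball z s, ENNReal.ofReal |f y - c| ∂μ ≤ ENNReal.ofReal A * μ (ball z s) := by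
    intro z s hs
    rcases lt_or_ge s (ρ z) with h | h
    · exact ⟨_, hconv z s _ hs (hbmo.1 z s hs h)⟩
    · exact ⟨0, hconv z s 0 hs (by simpa using hbmo.2 z s h)⟩
  have hlarge : ∀ R, r ≤ R → ∫⁻ y in ball x R, ENNReal.ofReal |f y| ∂μ ≤
      ENNReal.ofReal A * μ (ball x R) := fun R hR => by
    simpa using hconv x R 0 (hr.trans_le hR) (by simpa using hbmo.2 x R (hρ.trans hR))
  simp_rw [maximalFn_eq_iSup_min hfm]
  rw [lintegral_iSup (fun m => measurable_iSup_ballAvg μ _)]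
  · refine iSup_le fun m => ?_
    refine hμ.lintegral_iSup_ballAvg_le (by simpa using hA)
      (ENNReal.mul_ne_top ENNReal.ofNat_ne_top ENNReal.ofReal_ne_top) (ENNReal.natCast_ne_top m)
      (fun _ => min_le_right _ _) (fun z s hs => ?_) x hr fun R hR => ?_
    · obtain ⟨c, hc⟩ := hosc z s hs
      exact hμ.lintegral_min_sub_ballAvg_le hs hfm.restrict hc m
    · refine (ballAvg_mono (fun y => min_le_left _ _) x R).trans ?_
      refine ((hμ.ballAvg_le_iff (hr.trans_le hR)).2 (hlarge R hR)).trans ?_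
      exact le_mul_of_one_le_left' (by norm_num)
  · intro i j hij y
    refine iSup_mono fun z => iSup_mono fun s => iSup_mono fun _ => ballAvg_mono (fun y => ?_) z s
    exact min_le_min le_rfl (by exact_mod_cast hij)

end Doubling


section ReflectionWeight

variable {E : Type*} [NormedAddCommGroup E] [InnerProductSpace ℝ E]

/-- Every ball contains a comparable ball which stays away from finitely many hyperplanes whose
normals lie in a common open half space. -/
theorem exists_subball_away_from_hyperplanes (P : Finset E) (b : E)
    (hb : ∀ ζ ∈ P, 0 < ⟪ζ, b⟫) (hnorm : ∀ ζ ∈ P, ‖ζ‖ ≤ 2) :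
    ∃ δ : ℝ, 0 < δ ∧ ∀ (x : E) (r : ℝ), 0 < r →
      ∃ y : E, ball y (δ * r) ⊆ ball x r ∧ ∀ z ∈ ball y (δ * r), ∀ ζ ∈ P, δ * r ≤ |⟪ζ, z⟫| := by
  obtain ⟨β, hβ, hβb⟩ : ∃ β : ℝ, 0 < β ∧ ∀ ζ ∈ P, β ≤ ⟪ζ, b⟫ := by
    rcases P.eq_empty_or_nonempty with rfl | hP
    · exact ⟨1, one_pos, by simp⟩
    · obtain ⟨ζ₀, hζ₀, hmin⟩ := P.exists_min_image (fun ζ => ⟪ζ, b⟫) hP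
      exact ⟨_, hb ζ₀ hζ₀, hmin⟩
  set η : ℝ := 1 / (2 * ((P.card + 1) * (‖b‖ + 1))) with hη
  have hη0 : 0 < η := by positivity
  have hηN : (P.card + 1) * η * ‖b‖ ≤ 1 / 2 := by
    rw [hη]
    have : 0 ≤ ‖b‖ := norm_nonneg b
    field_simp
    linarith
  set δ : ℝ := min (1 / 2) (η * β / 8) with hδ
  have hδ0 : 0 < δ := by positivity
  have hδ1 : δ ≤ 1 / 2 := min_le_left _ _
  have hδ2 : δ ≤ η * β / 8 := min_le_right _ _
  refine ⟨δ, hδ0, fun x r hr => ?_⟩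
  obtain ⟨i, hi, hgood⟩ : ∃ i ∈ Finset.range (P.card + 1), ∀ ζ ∈ P,
      η * β / 2 * r ≤ |⟪ζ, x + (i * η * r) • b⟫| := by
    by_contra! hbad
    choose! ζ hζP hζ using hbad
    obtain ⟨i, hi, j, hj, hij, heq⟩ := Finset.exists_ne_map_eq_of_card_lt_of_maps_to
      (s := Finset.range (P.card + 1)) (t := P) (by simp) (f := ζ) fun i hi => hζP i hi
    have h1 := hζ i hi
    have h2 := hζ j hj
    rw [← heq] at h2
    have hβ' := hβb _ (hζP i hi)
    rw [inner_add_right, inner_smul_right] at h1 h2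
    have h3 : |((i : ℝ) - j) * (η * r * ⟪ζ i, b⟫)| < η * β * r := by
      calc |((i : ℝ) - j) * (η * r * ⟪ζ i, b⟫)|
          = |(⟪ζ i, x⟫ + i * η * r * ⟪ζ i, b⟫) - (⟪ζ i, x⟫ + j * η * r * ⟪ζ i, b⟫)| := by
            congr 1; ring
        _ ≤ _ := abs_sub _ _
        _ < η * β * r := by linarith
    have h4 : (1 : ℝ) ≤ |(i : ℝ) - j| := by
      have : (1 : ℤ) ≤ |(i : ℤ) - j| := Int.one_le_abs (by omega)
      exact_mod_cast this
    rw [abs_mul, abs_of_pos (a := η * r * ⟪ζ i, b⟫) (by have := hβ.trans_le hβ'; positivity)] at h3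
    have h5 : η * r * β ≤ η * r * ⟪ζ i, b⟫ := by gcongr
    have h6 : 0 < η * r * β := by positivity
    nlinarith
  refine ⟨x + (i * η * r) • b, ball_subset_ball' ?_, fun z hz ζ hζ => ?_⟩
  · rw [dist_eq_norm, add_sub_cancel_left, norm_smul, Real.norm_of_nonneg (by positivity)]
    have hi' : (i : ℝ) ≤ P.card + 1 := by exact_mod_cast (Finset.mem_range.1 hi).le
    have : (i : ℝ) * η * ‖b‖ ≤ 1 / 2 := le_trans (by gcongr) hηN
    nlinarith
  · have h1 := hgood ζ hζ
    set y := x + (i * η * r) • b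
    have h2 : |⟪ζ, y - z⟫| ≤ 2 * (δ * r) := by
      refine (abs_real_inner_le_norm _ _).trans ?_
      gcongr
      · exact hnorm ζ hζ
      · rw [mem_ball', dist_eq_norm] at hz
        exact hz.le
    have h3 : |⟪ζ, y⟫| ≤ |⟪ζ, z⟫| + |⟪ζ, y - z⟫| := by
      rw [inner_sub_right]
      have := abs_add_le ⟪ζ, z⟫ (⟪ζ, y⟫ - ⟪ζ, z⟫)
      rwa [add_sub_cancel] at this
    nlinarith

variable [MeasurableSpace E] [BorelSpace E] [FiniteDimensional ℝ E]

theorem exists_isBallDoubling_prod_abs_inner_rpow (P : Finset E) (b : E)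
    (hb : ∀ ζ ∈ P, 0 < ⟪ζ, b⟫) (hnorm : ∀ ζ ∈ P, ‖ζ‖ ≤ 2) (k : E → ℝ) (hk : ∀ ζ ∈ P, 0 ≤ k ζ) :
    ∃ D : ℝ≥0∞, IsBallDoubling_s18
      (volume.withDensity fun x : E => ENNReal.ofReal (∏ ζ ∈ P, |⟪ζ, x⟫| ^ (2 * k ζ))) D := by
  obtain ⟨δ, hδ, hsub⟩ := exists_subball_away_from_hyperplanes P b hb hnorm
  set w : E → ℝ := fun x => ∏ ζ ∈ P, |⟪ζ, x⟫| ^ (2 * k ζ) with hw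
  set K : ℝ := ∏ ζ ∈ P, (1 + 6 / δ) ^ (2 * k ζ) with hK
  have hK0 : 0 < K := Finset.prod_pos fun ζ _ => by positivity
  set μ : Measure E := volume.withDensity fun x => ENNReal.ofReal (w x) with hμ
  have hcomp : ∀ (x : E) (r : ℝ), 0 < r → ∃ y : E, 0 < w y ∧
      ENNReal.ofReal (w y / K) * volume (ball y (δ * r)) ≤ μ (ball x r) ∧
      μ (ball x (2 * r)) ≤ ENNReal.ofReal (K * w y) * volume (ball x (2 * r)) := by
    intro x r hr
    obtain ⟨y, hyx, hy⟩ := hsub x r hr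
    have hyy : y ∈ ball y (δ * r) := mem_ball_self (by positivity)
    have hle : ∀ z ∈ ball y (δ * r), ∀ z' ∈ ball x (2 * r), w z' ≤ K * w z := by
      intro z hz z' hz'
      rw [hK, hw, ← Finset.prod_mul_distrib]
      refine Finset.prod_le_prod (fun ζ _ => by positivity) fun ζ hζ => ?_
      rw [← Real.mul_rpow (by positivity) (abs_nonneg _)]
      refine Real.rpow_le_rpow (abs_nonneg _) ?_ (by have := hk ζ hζ; positivity)
      have h1 := hy z hz ζ hζ
      have h2 : |⟪ζ, z' - z⟫| ≤ 2 * (3 * r) := by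
        refine (abs_real_inner_le_norm _ _).trans ?_
        gcongr
        · exact hnorm ζ hζ
        · rw [← dist_eq_norm]
          have h3 := dist_triangle_right z' z x
          have h4 := mem_ball.1 (hyx hz)
          rw [mem_ball] at hz'
          linarith
      have h3 : |⟪ζ, z'⟫| ≤ |⟪ζ, z⟫| + |⟪ζ, z' - z⟫| := by
        rw [inner_sub_right]
        have := abs_add_le ⟪ζ, z⟫ (⟪ζ, z'⟫ - ⟪ζ, z⟫)
        rwa [add_sub_cancel] at this
      have h4 : 2 * (3 * r) ≤ 6 / δ * |⟪ζ, z⟫| := by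
        rw [div_mul_eq_mul_div, le_div_iff₀ hδ]
        linarith
      linarith
    refine ⟨y, Finset.prod_pos fun ζ hζ => ?_, ?_, ?_⟩
    · exact Real.rpow_pos_of_pos ((by positivity : 0 < δ * r).trans_le (hy y hyy ζ hζ)) _
    · refine le_trans ?_ (measure_mono hyx)
      rw [hμ, withDensity_apply _ measurableSet_ball, ← setLIntegral_const]
      refine setLIntegral_mono' measurableSet_ball fun z hz => ENNReal.ofReal_le_ofReal ?_
      rw [div_le_iff₀' hK0]
      exact hle z hz y (ball_subset_ball (by linarith) (hyx hyy))
    · rw [hμ, withDensity_apply _ measurableSet_ball, ← setLIntegral_const]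
      exact setLIntegral_mono' measurableSet_ball fun z hz =>
        ENNReal.ofReal_le_ofReal (hle y hyy z hz)
  refine ⟨1 + ENNReal.ofReal (K * K * (2 / δ) ^ Module.finrank ℝ E), ?_, ?_, ?_, le_self_add, by simp⟩
  · intro x r hr
    obtain ⟨y, hwy, hlow, -⟩ := hcomp x r hr
    refine (lt_of_lt_of_le ?_ hlow).ne'
    exact ENNReal.mul_pos (by simpa using div_pos hwy hK0) (measure_ball_pos _ _ (by positivity)).ne'
  · intro x r
    rcases le_or_gt r 0 with hr | hr
    · simp [ball_eq_empty.2 hr]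
    · obtain ⟨y, hwy, -, hup⟩ := hcomp x r hr
      refine ((measure_mono (ball_subset_ball (by linarith))).trans_lt
        (hup.trans_lt (ENNReal.mul_lt_top (by simp) measure_ball_lt_top))).ne
  · intro x r hr
    obtain ⟨y, hwy, hlow, hup⟩ := hcomp x r hr
    refine le_trans ?_ (mul_le_mul_left le_add_self _)
    refine hup.trans (le_trans (le_of_eq ?_) (mul_le_mul_right hlow _))
    have h2 : (2 : ℝ) * r = 2 / δ * (δ * r) := by field_simp
    rw [h2, Measure.addHaar_ball_mul_of_pos volume x (by positivity),
      ← Measure.addHaar_ball_center volume y, ← mul_assoc, ← mul_assoc,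
      ← ENNReal.ofReal_mul (by positivity), ← ENNReal.ofReal_mul (by positivity)]
    congr 2
    field_simp

end ReflectionWeight

/-- There is `C > 0` such that for every `f ∈ BMO(𝓛_k)` and every ball `B = B(x₀, r₀)` with
`r₀ ≥ ρ_k(x₀)`, `ω_k(B)⁻¹ ∫_B M_k f dω_k ≤ C ‖f‖_(BMO(𝓛_k))`. -/
theorem maximal_average_large_balls
    (n : ℕ) (hn : 0 < n)
    (Rs Rp : Finset (EuclideanSpace ℝ (Fin n)))
    (hRs0 : (0 : EuclideanSpace ℝ (Fin n)) ∉ Rs)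
    (hRsnorm : ∀ ζ ∈ Rs, ⟪ζ, ζ⟫ = (2 : ℝ))
    (hRsrefl : ∀ ζ ∈ Rs, ∀ η ∈ Rs, η - ⟪η, ζ⟫ • ζ ∈ Rs)
    (hRsline : ∀ ζ ∈ Rs, ∀ c : ℝ, c • ζ ∈ Rs → c = 1 ∨ c = -1)
    (b : EuclideanSpace ℝ (Fin n))
    (hRpdef : ∀ ζ ∈ Rs, (ζ ∈ Rp ↔ 0 < ⟪ζ, b⟫)) (hRpsub : Rp ⊆ Rs)
    (k : EuclideanSpace ℝ (Fin n) → ℝ)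
    (hk0 : ∀ ζ ∈ Rs, 0 ≤ k ζ)
    (hkinv : ∀ ζ ∈ Rs, ∀ η ∈ Rs, k (η - ⟪η, ζ⟫ • ζ) = k η)
    (w : EuclideanSpace ℝ (Fin n) → ℝ)
    (hw : ∀ x, w x = ∏ ζ ∈ Rp, |⟪ζ, x⟫| ^ (2 * k ζ))
    (γ : ℝ) (hγ : γ = ∑ ζ ∈ Rp, k ζ)
    (μ : Measure (EuclideanSpace ℝ (Fin n)))
    (hμ : μ = volume.withDensity (fun x => ENNReal.ofReal (w x)))
    (V : EuclideanSpace ℝ (Fin n) → ℝ)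
    (hV0 : ∀ x, 0 ≤ V x)
    (hVloc : LocallyIntegrable V μ)
    (hVne : ¬ (∀ᵐ x ∂μ, V x = 0))
    (q : ℝ) (hq : max 1 (((n : ℝ) + 2 * γ) / 2) < q)
    (C_RH : ℝ) (hC_RH : 0 < C_RH)
    (hRH : ∀ (x : EuclideanSpace ℝ (Fin n)) (r : ℝ), 0 < r →
      (⨍ y in Metric.ball x r, V y ^ q ∂μ) ^ (1 / q) ≤
        C_RH * ⨍ y in Metric.ball x r, V y ∂μ)
    (ρ : EuclideanSpace ℝ (Fin n) → ℝ)
    (hρdef : ∀ x, ρ x = sSup {r : ℝ | 0 < r ∧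
      r ^ 2 / (μ (Metric.ball x r)).toReal * ∫ y in Metric.ball x r, V y ∂μ ≤ 1})
    (hρpos : ∀ x, 0 < ρ x)
    :
    ∃ C : ℝ, 0 < C ∧
      ∀ f : EuclideanSpace ℝ (Fin n) → ℝ, LocallyIntegrable f μ →
      ∀ Cf : ℝ, 0 ≤ Cf → IsBMOL μ ρ f Cf →
      ∀ (x₀ : EuclideanSpace ℝ (Fin n)) (r₀ : ℝ), ρ x₀ ≤ r₀ →
        (μ (Metric.ball x₀ r₀))⁻¹ * ∫⁻ x in Metric.ball x₀ r₀, maximalFn μ f x ∂μ ≤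
          ENNReal.ofReal (C * Cf) := by
  have hnorm : ∀ ζ ∈ Rp, ‖ζ‖ ≤ 2 := fun ζ hζ => by
    have h := hRsnorm ζ (hRpsub hζ)
    rw [real_inner_self_eq_norm_sq] at h
    nlinarith [norm_nonneg ζ]
  obtain ⟨D, hD⟩ := exists_isBallDoubling_prod_abs_inner_rpow Rp b
    (fun ζ hζ => (hRpdef ζ (hRpsub hζ)).1 hζ) hnorm k fun ζ hζ => hk0 ζ (hRpsub hζ)
  simp_rw [← hw, ← hμ] at hD
  set K : ℝ≥0∞ := (1 + D ^ 3 + 4 * D ^ 6 * (2 + D ^ 2)) * 2 with hK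
  have hKtop : K ≠ ∞ := by
    have := hD.const_ne_top
    finiteness
  have hK0 : K ≠ 0 := by simp [hK]
  refine ⟨K.toReal, ENNReal.toReal_pos hK0 hKtop, fun f hf Cf hCf hbmo x₀ r₀ hr₀ => ?_⟩
  have hr : 0 < r₀ := (hρpos x₀).trans_le hr₀
  have hA : ∀ A : ℝ, Cf < A →
      (μ (ball x₀ r₀))⁻¹ * ∫⁻ x in ball x₀ r₀, maximalFn μ f x ∂μ ≤
        ENNReal.ofReal (K.toReal * A) := by
    intro A hA
    have hbmo' : IsBMOL μ ρ f A :=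
      ⟨fun x s hs hsρ => (hbmo.1 x s hs hsρ).trans hA.le, fun x r hr => (hbmo.2 x r hr).trans hA.le⟩
    have h := hbmo'.lintegral_maximalFn_le hD hf (hCf.trans_lt hA) hr hr₀
    rw [ENNReal.ofReal_mul ENNReal.toReal_nonneg, ENNReal.ofReal_toReal hKtop, hK, mul_assoc]
    exact (hD.ballAvg_le_iff hr).2 h
  refine ge_of_tendsto (x := 𝓝[>] Cf) ?_ (eventually_mem_nhdsWithin.mono hA)
  have : Continuous fun A : ℝ => ENNReal.ofReal (K.toReal * A) :=
    ENNReal.continuous_ofReal.comp (by fun_prop)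
  exact (this.tendsto Cf).mono_left nhdsWithin_le_nhds
end
end

section
/- There exists a constant C > 0 such that for every f ∈ BMO(𝓛_k), every x₀ ∈ ℝ^n, and every 0 < r₀ < ρ_k(x₀), the ball B₀ = B(x₀,r₀) satisfies ω_k(B₀)^{-1} ∫_{B₀} |M_k f − (M_k f)_{B₀}| dω_k ≤ C·‖f‖_{BMO(𝓛_k)}, where (M_k f)_{B₀} = ω_k(B₀)^{-1}∫_{B₀} M_k f dω_k. Consequently, combined with the corresponding average bound on balls of radius at least the critical radius, M_k f ∈ BMO(𝓛_k) with ‖M_k f‖_{BMO(𝓛_k)} ≤ C·‖f‖_{BMO(𝓛_k)}. -/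
open MeasureTheory Metric Real
open scoped ENNReal RealInnerProductSpace
set_option linter.unusedVariables false

noncomputable section

/-- A measure that is positive and finite on balls and doubling with constant `D`. -/
structure IsBallDoubling_s19 {α : Type*} [MeasurableSpace α] [PseudoMetricSpace α]
    (μ : Measure α) (D : ℝ≥0∞) : Prop where
  one_le : 1 ≤ D
  ne_top : D ≠ ∞
  ball_ne_zero : ∀ (y : α) (r : ℝ), 0 < r → μ (ball y r) ≠ 0
  ball_ne_top : ∀ (y : α) (r : ℝ), μ (ball y r) ≠ ∞
  doubling : ∀ (y : α) (r : ℝ), 0 < r → μ (ball y (2 * r)) ≤ D * μ (ball y r)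

/-- The mean of `|f - c|` over `ball y r`. -/
def meanDev {α : Type*} [MeasurableSpace α] [PseudoMetricSpace α]
    (μ : Measure α) (f : α → ℝ) (c : ℝ) (y : α) (r : ℝ) : ℝ≥0∞ :=
  (μ (ball y r))⁻¹ * ∫⁻ z in ball y r, ‖f z - c‖ₑ ∂μ

/-- The points `x` of `ball x₀ r` lying in a ball of radius at most `r` over which the mean of
`|f - a x₀ r|` exceeds `t`. -/
def devLevelSet {α : Type*} [MeasurableSpace α] [PseudoMetricSpace α]
    (μ : Measure α) (f : α → ℝ) (a : α → ℝ → ℝ) (t : ℝ≥0∞) (x₀ : α) (r : ℝ) : Set α :=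
  {x | x ∈ ball x₀ r ∧ ∃ y s, s ≤ r ∧ x ∈ ball y s ∧ t < meanDev μ f (a x₀ r) y s}

section Doubling

variable {α : Type*} [MeasurableSpace α] [PseudoMetricSpace α]
  {μ : Measure α} {D : ℝ≥0∞} {f : α → ℝ}

lemma IsBallDoubling_s19.measure_ball_two_pow_mul_le (h : IsBallDoubling_s19 μ D) (y : α) {r : ℝ}
    (hr : 0 < r) (j : ℕ) : μ (ball y (2 ^ j * r)) ≤ D ^ j * μ (ball y r) := by
  induction j with
  | zero => simp
  | succ j ih =>
    calc μ (ball y (2 ^ (j + 1) * r)) = μ (ball y (2 * (2 ^ j * r))) := by ring_nf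
      _ ≤ D * μ (ball y (2 ^ j * r)) := h.doubling _ _ (by positivity)
      _ ≤ D * (D ^ j * μ (ball y r)) := by gcongr
      _ = D ^ (j + 1) * μ (ball y r) := by ring

lemma IsBallDoubling_s19.measure_ball_le (h : IsBallDoubling_s19 μ D) {y z : α} {s t : ℝ}
    (hs : 0 < s) (j : ℕ) (hj : t + dist z y ≤ 2 ^ j * s) :
    μ (ball z t) ≤ D ^ j * μ (ball y s) :=
  (measure_mono (ball_subset_ball' hj)).trans (h.measure_ball_two_pow_mul_le y hs j)

lemma IsBallDoubling_s19.lintegral_eq (h : IsBallDoubling_s19 μ D) (c : ℝ) (y : α) {r : ℝ}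
    (hr : 0 < r) :
    ∫⁻ z in ball y r, ‖f z - c‖ₑ ∂μ = μ (ball y r) * meanDev μ f c y r := by
  rw [meanDev, ← mul_assoc, ENNReal.mul_inv_cancel (h.ball_ne_zero y r hr) (h.ball_ne_top y r),
    one_mul]

lemma IsBallDoubling_s19.meanDev_le_add (h : IsBallDoubling_s19 μ D) (c c' : ℝ) (y : α) {r : ℝ}
    (hr : 0 < r) : meanDev μ f c y r ≤ meanDev μ f c' y r + ‖c' - c‖ₑ := by
  calc meanDev μ f c y r
      ≤ (μ (ball y r))⁻¹ * ∫⁻ z in ball y r, (‖f z - c'‖ₑ + ‖c' - c‖ₑ) ∂μ := by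
        unfold meanDev
        gcongr with z
        calc ‖f z - c‖ₑ = ‖(f z - c') + (c' - c)‖ₑ := by ring_nf
          _ ≤ _ := enorm_add_le _ _
    _ = meanDev μ f c' y r + ‖c' - c‖ₑ := by
        rw [lintegral_add_right _ measurable_const, lintegral_const, Measure.restrict_apply_univ,
          mul_add, mul_comm ‖c' - c‖ₑ, ← mul_assoc (μ (ball y r))⁻¹ (μ (ball y r)),
          ENNReal.inv_mul_cancel (h.ball_ne_zero y r hr) (h.ball_ne_top y r), one_mul, meanDev]

lemma IsBallDoubling_s19.enorm_sub_le (h : IsBallDoubling_s19 μ D) (hf : AEMeasurable f μ) (c c' : ℝ)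
    (y : α) {r : ℝ} (hr : 0 < r) :
    ‖c - c'‖ₑ ≤ meanDev μ f c y r + meanDev μ f c' y r := by
  calc ‖c - c'‖ₑ = (μ (ball y r))⁻¹ * ∫⁻ _ in ball y r, ‖c - c'‖ₑ ∂μ := by
        rw [lintegral_const, Measure.restrict_apply_univ, mul_comm ‖c - c'‖ₑ, ← mul_assoc,
          ENNReal.inv_mul_cancel (h.ball_ne_zero y r hr) (h.ball_ne_top y r), one_mul]
    _ ≤ (μ (ball y r))⁻¹ * ∫⁻ z in ball y r, (‖f z - c‖ₑ + ‖f z - c'‖ₑ) ∂μ := by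
        gcongr with z
        calc ‖c - c'‖ₑ = ‖(f z - c') - (f z - c)‖ₑ := by ring_nf
          _ ≤ ‖f z - c'‖ₑ + ‖f z - c‖ₑ := _root_.enorm_sub_le
          _ = _ := add_comm _ _
    _ = _ := by
        rw [lintegral_add_left' (hf.restrict.sub_const c).enorm, mul_add, meanDev, meanDev]

lemma IsBallDoubling_s19.meanDev_le_mul (h : IsBallDoubling_s19 μ D) {c : ℝ} {y z : α} {s t : ℝ}
    {K : ℝ≥0∞} (hs : 0 < s) (hsub : ball y s ⊆ ball z t)
    (hK : μ (ball z t) ≤ K * μ (ball y s)) : meanDev μ f c y s ≤ K * meanDev μ f c z t := by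
  have ht : 0 < t := nonempty_ball.1 ⟨y, hsub (mem_ball_self hs)⟩
  calc meanDev μ f c y s ≤ (μ (ball y s))⁻¹ * ∫⁻ z in ball z t, ‖f z - c‖ₑ ∂μ := by
        unfold meanDev
        gcongr
    _ ≤ (μ (ball y s))⁻¹ * ((K * μ (ball y s)) * meanDev μ f c z t) := by
        rw [h.lintegral_eq c z ht]
        gcongr
    _ = ((μ (ball y s))⁻¹ * μ (ball y s)) * (K * meanDev μ f c z t) := by ring
    _ = _ := by
        rw [ENNReal.inv_mul_cancel (h.ball_ne_zero y s hs) (h.ball_ne_top y s), one_mul]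

/-- The constants of two nested comparable balls differ by a multiple of the oscillation. -/
lemma IsBallDoubling_s19.enorm_const_sub_le (h : IsBallDoubling_s19 μ D) (hf : AEMeasurable f μ)
    {a : α → ℝ → ℝ} {A : ℝ≥0∞} (ha : ∀ y r, 0 < r → meanDev μ f (a y r) y r ≤ A)
    {y z : α} {s t : ℝ} (hs : 0 < s) (hsub : ball y s ⊆ ball z t) (j : ℕ)
    (hj : t + dist z y ≤ 2 ^ j * s) : ‖a y s - a z t‖ₑ ≤ (1 + D ^ j) * A := by
  have ht : 0 < t := nonempty_ball.1 ⟨y, hsub (mem_ball_self hs)⟩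
  calc ‖a y s - a z t‖ₑ ≤ meanDev μ f (a y s) y s + meanDev μ f (a z t) y s :=
        h.enorm_sub_le hf _ _ y hs
    _ ≤ A + D ^ j * A := by
        gcongr
        · exact ha y s hs
        · exact (h.meanDev_le_mul hs hsub (h.measure_ball_le hs j hj)).trans
            (by gcongr; exact ha z t ht)
    _ = _ := by ring

lemma exists_mem_forall_le_two_mul {S : Set ℝ} {R : ℝ} (hS : S.Nonempty)
    (hpos : ∀ s ∈ S, 0 < s) (hR : ∀ s ∈ S, s ≤ R) : ∃ s ∈ S, ∀ s' ∈ S, s' ≤ 2 * s := by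
  have hb : BddAbove S := ⟨R, hR⟩
  obtain ⟨s₁, hs₁⟩ := hS
  have h0 : 0 < sSup S := (hpos s₁ hs₁).trans_le (le_csSup hb hs₁)
  obtain ⟨s, hs, hlt⟩ := exists_lt_of_lt_csSup ⟨s₁, hs₁⟩ (half_lt_self h0)
  exact ⟨s, hs, fun s' hs' => by linarith [le_csSup hb hs']⟩

/-- Each point of a level set lies in a ball of almost maximal radius among those over which the
mean deviation is large. -/
lemma exists_almost_maximal_ball {a : α → ℝ → ℝ} {t : ℝ≥0∞} {x₀ : α} {r : ℝ} {x : α}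
    (hx : x ∈ devLevelSet μ f a t x₀ r) :
    ∃ (y : α) (s : ℝ), 0 < s ∧ s ≤ r ∧ x ∈ ball y s ∧ t < meanDev μ f (a x₀ r) y s ∧
      ∀ (y' : α) (s' : ℝ), s' ≤ r → x ∈ ball y' s' → t < meanDev μ f (a x₀ r) y' s' →
        s' ≤ 2 * s := by
  obtain ⟨-, y, s, hs, hxs, ht⟩ := hx
  obtain ⟨s₁, ⟨y₁, h₁, h₂, h₃⟩, hmax⟩ := exists_mem_forall_le_two_mul
    (S := {s | ∃ y, s ≤ r ∧ x ∈ ball y s ∧ t < meanDev μ f (a x₀ r) y s}) (R := r)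
    ⟨s, y, hs, hxs, ht⟩ (fun s ⟨y, _, h, _⟩ => pos_of_mem_ball h) (fun s ⟨y, h, _⟩ => h)
  exact ⟨y₁, s₁, pos_of_mem_ball h₂, h₁, h₂, h₃, fun y' s' p q w => hmax s' ⟨y', p, q, w⟩⟩

lemma devLevelSet_anti {a : α → ℝ → ℝ} {t t' : ℝ≥0∞} (h : t ≤ t') (x₀ : α) (r : ℝ) :
    devLevelSet μ f a t' x₀ r ⊆ devLevelSet μ f a t x₀ r :=
  fun _ ⟨hx, y, s, h₁, h₂, h₃⟩ => ⟨hx, y, s, h₁, h₂, h.trans_lt h₃⟩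

lemma devLevelSet_subset_ball {a : α → ℝ → ℝ} {t : ℝ≥0∞} (x₀ : α) (r : ℝ) :
    devLevelSet μ f a t x₀ r ⊆ ball x₀ r :=
  fun _ hx => hx.1

lemma isOpen_devLevelSet {a : α → ℝ → ℝ} {t : ℝ≥0∞} (x₀ : α) (r : ℝ) :
    IsOpen (devLevelSet μ f a t x₀ r) := by
  have : devLevelSet μ f a t x₀ r = ball x₀ r ∩
      ⋃ (y : α) (s : ℝ) (_ : s ≤ r ∧ t < meanDev μ f (a x₀ r) y s), ball y s := by
    ext x
    simp only [devLevelSet, Set.mem_ofPred_eq, Set.mem_inter_iff, Set.mem_iUnion, exists_prop]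
    grind
  rw [this]
  exact isOpen_ball.inter (isOpen_iUnion fun _ => isOpen_iUnion fun _ => isOpen_iUnion fun _ =>
    isOpen_ball)

/-- The level at which the balls of the stopping-time decomposition are selected. -/
def selectionLevel (D : ℝ≥0∞) (A : ℝ≥0∞) : ℝ≥0∞ := 2 * D ^ 5 * (2 + D ^ 2) * A

/-- The increment of level after which the level sets shrink by a factor of two. -/
def levelStep (D : ℝ≥0∞) (A : ℝ≥0∞) : ℝ≥0∞ := selectionLevel D A + (2 + D ^ 2 + D ^ 6) * A

lemma IsBallDoubling_s19.tsum_measure_le [OpensMeasurableSpace α]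
    (h : IsBallDoubling_s19 μ D) (hf : AEMeasurable f μ)
    {a : α → ℝ → ℝ} {A : ℝ≥0∞} (ha : ∀ y r, 0 < r → meanDev μ f (a y r) y r ≤ A)
    (hA₀ : A ≠ 0) (hA : A ≠ ∞) {x₀ : α} {r : ℝ} (hr : 0 < r)
    {u : Set α} (hu : u.Countable) {y : α → α} {s : α → ℝ}
    (hdisj : u.PairwiseDisjoint fun i => ball (y i) (s i))
    (hs : ∀ i ∈ u, 0 < s i) (hsub : ∀ i ∈ u, ball (y i) (s i) ⊆ ball x₀ (2 ^ 2 * r))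
    (hlt : ∀ i ∈ u, selectionLevel D A < meanDev μ f (a x₀ r) (y i) (s i)) :
    ∑' i : u, μ (ball (y i) (2 ^ 3 * s i)) ≤ 2⁻¹ * μ (ball x₀ r) := by
  have hD0 : D ≠ 0 := (zero_lt_one.trans_le h.one_le).ne'
  have hDt := h.ne_top
  have ht0 : selectionLevel D A ≠ 0 := by simp [selectionLevel, hD0, hA₀]
  have htt : selectionLevel D A ≠ ∞ := by
    unfold selectionLevel; finiteness
  have h4r : 0 < 2 ^ 2 * r := by positivity
  have hint : ∫⁻ z in ball x₀ (2 ^ 2 * r), ‖f z - a x₀ r‖ₑ ∂μ ≤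
      D ^ 2 * μ (ball x₀ r) * ((2 + D ^ 2) * A) := by
    rw [h.lintegral_eq _ _ h4r]
    gcongr
    · exact h.measure_ball_two_pow_mul_le x₀ hr 2
    · calc _ ≤ _ := h.meanDev_le_add (a x₀ r) (a x₀ (2 ^ 2 * r)) x₀ h4r
        _ ≤ A + (1 + D ^ 2) * A := by
          gcongr
          · exact ha _ _ h4r
          · rw [enorm_sub_rev]
            exact h.enorm_const_sub_le hf ha hr (ball_subset_ball (by linarith)) 2 (by simp)
        _ = _ := by ring
  have hball : ∀ i ∈ u, μ (ball (y i) (s i)) ≤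
      (selectionLevel D A)⁻¹ * ∫⁻ z in ball (y i) (s i), ‖f z - a x₀ r‖ₑ ∂μ := by
    intro i hi
    rw [h.lintegral_eq _ _ (hs i hi)]
    calc μ (ball (y i) (s i))
        = (selectionLevel D A)⁻¹ * (μ (ball (y i) (s i)) * selectionLevel D A) := by
          rw [mul_comm (μ _), ← mul_assoc, ENNReal.inv_mul_cancel ht0 htt, one_mul]
      _ ≤ _ := by gcongr; exact (hlt i hi).le
  have := hu.to_subtype
  calc ∑' i : u, μ (ball (y i) (2 ^ 3 * s i))
      ≤ ∑' i : u, D ^ 3 * ((selectionLevel D A)⁻¹ *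
          ∫⁻ z in ball (y i) (s i), ‖f z - a x₀ r‖ₑ ∂μ) := by
        refine ENNReal.tsum_le_tsum fun i => ?_
        refine (h.measure_ball_two_pow_mul_le _ (hs i i.2) 3).trans ?_
        gcongr
        exact hball i i.2
    _ = D ^ 3 * (selectionLevel D A)⁻¹ *
          ∫⁻ z in ⋃ i ∈ u, ball (y i) (s i), ‖f z - a x₀ r‖ₑ ∂μ := by
        rw [ENNReal.tsum_mul_left, ENNReal.tsum_mul_left, mul_assoc,
          lintegral_biUnion hu (fun _ _ => measurableSet_ball) hdisj]
    _ ≤ D ^ 3 * (selectionLevel D A)⁻¹ * (D ^ 2 * μ (ball x₀ r) * ((2 + D ^ 2) * A)) := by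
        gcongr
        refine (lintegral_mono_set (Set.iUnion₂_subset hsub)).trans hint
    _ = 2⁻¹ * ((selectionLevel D A)⁻¹ * selectionLevel D A) * μ (ball x₀ r) := by
        have h2 : (2 : ℝ≥0∞)⁻¹ * 2 = 1 := ENNReal.inv_mul_cancel (by simp) (by simp)
        calc _ = 1 * (selectionLevel D A)⁻¹ * (D ^ 5 * (2 + D ^ 2) * A) * μ (ball x₀ r) := by ring
          _ = 2⁻¹ * ((selectionLevel D A)⁻¹ * (2 * D ^ 5 * (2 + D ^ 2) * A)) * μ (ball x₀ r) := by
            rw [← h2]; ring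
    _ = _ := by rw [ENNReal.inv_mul_cancel ht0 htt, mul_one]

/-- Stopping-time covering of the higher level sets. -/
lemma IsBallDoubling_s19.exists_cover_devLevelSet [OpensMeasurableSpace α]
    [SecondCountableTopology α] (h : IsBallDoubling_s19 μ D) (hf : AEMeasurable f μ)
    {a : α → ℝ → ℝ} {A : ℝ≥0∞} (ha : ∀ y r, 0 < r → meanDev μ f (a y r) y r ≤ A)
    (hA₀ : A ≠ 0) (hA : A ≠ ∞) (x₀ : α) {r : ℝ} (hr : 0 < r) :
    ∃ (u : Set α) (y : α → α) (s : α → ℝ), u.Countable ∧ (∀ i ∈ u, 0 < s i) ∧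
      ∑' i : u, μ (ball (y i) (s i)) ≤ 2⁻¹ * μ (ball x₀ r) ∧
      ∀ t, devLevelSet μ f a (t + levelStep D A) x₀ r ⊆
        ⋃ i ∈ u, devLevelSet μ f a t (y i) (s i) := by
  choose! y s hs0 hsr hxs hlt hmax using
    fun x (hx : x ∈ devLevelSet μ f a (selectionLevel D A) x₀ r) => exists_almost_maximal_ball hx
  obtain ⟨u, hut, hdisj, hcov⟩ := Vitali.exists_disjoint_subfamily_covering_enlargement
    (fun i => ball (y i) (s i)) (devLevelSet μ f a (selectionLevel D A) x₀ r) s 2 one_lt_two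
    (fun i hi => (hs0 i hi).le) r hsr (fun i hi => ⟨i, hxs i hi⟩)
  have huc : u.Countable := hdisj.countable_of_isOpen (fun _ _ => isOpen_ball)
    (fun i hi => ⟨i, hxs i (hut hi)⟩)
  refine ⟨u, y, fun i => 2 ^ 3 * s i, huc, fun i hi => by have := hs0 i (hut hi); positivity,
    h.tsum_measure_le hf ha hA₀ hA hr huc hdisj (fun i hi => hs0 i (hut hi)) (fun i hi => ?_)
      (fun i hi => hlt i (hut hi)), ?_⟩
  · have h1 := hsr i (hut hi)
    have h2 := mem_ball.1 (hxs i (hut hi))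
    have h3 := mem_ball.1 (hut hi).1
    refine ball_subset_ball' ?_
    linarith [dist_triangle_left (y i) x₀ i]
  intro t x hx
  have hxt : x ∈ devLevelSet μ f a (selectionLevel D A) x₀ r :=
    devLevelSet_anti (le_add_left le_self_add) _ _ hx
  obtain ⟨i, hi, ⟨z, hzx, hzi⟩, hsx⟩ := hcov x hxt
  have hi' := hut hi
  have hsi := hs0 i hi'
  have h8 : 0 < 2 ^ 3 * s i := by positivity
  simp only [mem_ball] at hzx hzi
  have hxy := mem_ball.1 (hxs x hxt)
  have hxi : dist x (y i) < 5 * s i := by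
    linarith [dist_triangle4 x (y x) z (y i), dist_comm z (y x)]
  have hdiff : ‖a (y i) (2 ^ 3 * s i) - a x₀ r‖ₑ ≤ levelStep D A := by
    have hiy := mem_ball.1 (hxs i hi')
    have hix := mem_ball.1 hi'.1
    have hsr' := hsr i hi'
    rcases le_or_gt (2 ^ 3 * s i) r with h8r | h8r
    · refine (h.enorm_sub_le hf _ _ (y i) h8).trans ?_
      calc _ ≤ A + selectionLevel D A := by
            gcongr
            · exact ha _ _ h8
            · by_contra! hcon
              have := hmax i hi' (y i) (2 ^ 3 * s i) h8r (mem_ball.2 (by linarith)) hcon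
              linarith
        _ ≤ levelStep D A := by
            rw [levelStep, add_comm]
            gcongr
            exact le_mul_of_one_le_left' (le_add_right (le_add_right (by norm_num)))
    · have hd : dist x₀ (y i) < r + s i := by
        linarith [dist_triangle_left x₀ (y i) i]
      have e1 := h.enorm_const_sub_le hf ha (y := y i) (z := y i) h8
        (t := 2 ^ 2 * (2 ^ 3 * s i)) (ball_subset_ball (by linarith)) 2 (by simp)
      have e2 := h.enorm_const_sub_le hf ha (y := x₀) (z := y i) hr
        (t := 2 ^ 2 * (2 ^ 3 * s i)) (ball_subset_ball' (by linarith)) 6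
        (by rw [dist_comm]; linarith)
      calc _ = ‖(a (y i) (2 ^ 3 * s i) - a (y i) (2 ^ 2 * (2 ^ 3 * s i))) -
              (a x₀ r - a (y i) (2 ^ 2 * (2 ^ 3 * s i)))‖ₑ := by ring_nf
        _ ≤ (1 + D ^ 2) * A + (1 + D ^ 6) * A := _root_.enorm_sub_le.trans (add_le_add e1 e2)
        _ = (2 + D ^ 2 + D ^ 6) * A := by ring
        _ ≤ _ := le_add_self
  obtain ⟨-, y', s', hs', hxs', hlt'⟩ := hx
  have hs2 := hmax x hxt y' s' hs' hxs' (lt_of_le_of_lt (le_add_left le_self_add) hlt')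
  refine Set.mem_biUnion hi ⟨mem_ball.2 (by linarith), y', s', by linarith, hxs', ?_⟩
  have key := h.meanDev_le_add (f := f) (a x₀ r) (a (y i) (2 ^ 3 * s i)) y' (pos_of_mem_ball hxs')
  have hTt : levelStep D A ≠ ∞ := by
    have := h.ne_top
    unfold levelStep selectionLevel; finiteness
  refine (ENNReal.add_lt_add_iff_right hTt).1 (hlt'.trans_le (key.trans ?_))
  gcongr

/-- Exponential decay of the level sets of the local maximal deviation. -/
lemma IsBallDoubling_s19.measure_devLevelSet_le [OpensMeasurableSpace α]
    [SecondCountableTopology α] (h : IsBallDoubling_s19 μ D) (hf : AEMeasurable f μ)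
    {a : α → ℝ → ℝ} {A : ℝ≥0∞} (ha : ∀ y r, 0 < r → meanDev μ f (a y r) y r ≤ A)
    (hA₀ : A ≠ 0) (hA : A ≠ ∞) (m : ℕ) (x₀ : α) {r : ℝ} (hr : 0 < r) :
    μ (devLevelSet μ f a (m * levelStep D A) x₀ r) ≤ 2⁻¹ ^ m * μ (ball x₀ r) := by
  induction m generalizing x₀ r with
  | zero => simpa using measure_mono (devLevelSet_subset_ball x₀ r)
  | succ m ih =>
    obtain ⟨u, y, s, hu, hs, hsum, hcov⟩ := h.exists_cover_devLevelSet hf ha hA₀ hA x₀ hr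
    calc μ (devLevelSet μ f a ((m + 1 : ℕ) * levelStep D A) x₀ r)
        ≤ μ (⋃ i ∈ u, devLevelSet μ f a (m * levelStep D A) (y i) (s i)) := by
          refine measure_mono ?_
          convert hcov (m * levelStep D A) using 2
          push_cast; ring
      _ ≤ ∑' i : u, μ (devLevelSet μ f a (m * levelStep D A) (y i) (s i)) :=
          measure_biUnion_le μ hu _
      _ ≤ ∑' i : u, 2⁻¹ ^ m * μ (ball (y i) (s i)) :=
          ENNReal.tsum_le_tsum fun i => ih (y i) (hs i i.2)
      _ ≤ 2⁻¹ ^ m * (2⁻¹ * μ (ball x₀ r)) := by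
          rw [ENNReal.tsum_mul_left]
          gcongr
      _ = _ := by ring

lemma le_tsum_ite_mul_lt (v : ℝ≥0∞) {T : ℝ≥0∞} (hT : T ≠ 0) :
    v ≤ ∑' m : ℕ, if m * T < v then T else 0 := by
  classical
  by_cases hall : ∀ m : ℕ, m * T < v
  · simp [hall, ENNReal.tsum_const_eq_top_of_ne_zero hT]
  · push Not at hall
    have hmin := fun m (hm : m < Nat.find hall) => not_le.1 (Nat.find_min hall hm)
    calc v ≤ Nat.find hall * T := Nat.find_spec hall
      _ = ∑ m ∈ Finset.range (Nat.find hall), if m * T < v then T else 0 := by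
        rw [Finset.sum_congr rfl fun m hm => if_pos (hmin m (Finset.mem_range.1 hm))]
        simp
      _ ≤ _ := ENNReal.sum_le_tsum _

/-- The sup of the mean deviations from `c` over the balls of radius at most `r` containing `x`. -/
def localMaximalDev (μ : Measure α) (f : α → ℝ) (c r : ℝ) (x : α) : ℝ≥0∞ :=
  ⨆ (y : α) (s : ℝ) (_ : s ≤ r) (_ : x ∈ ball y s), meanDev μ f c y s

lemma IsBallDoubling_s19.lintegral_localMaximalDev_le [OpensMeasurableSpace α]
    [SecondCountableTopology α] (h : IsBallDoubling_s19 μ D) (hf : AEMeasurable f μ)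
    {a : α → ℝ → ℝ} {A : ℝ≥0∞} (ha : ∀ y r, 0 < r → meanDev μ f (a y r) y r ≤ A)
    (hA₀ : A ≠ 0) (hA : A ≠ ∞) (x₀ : α) {r : ℝ} (hr : 0 < r) :
    ∫⁻ x in ball x₀ r, localMaximalDev μ f (a x₀ r) r x ∂μ ≤
      2 * levelStep D A * μ (ball x₀ r) := by
  set T := levelStep D A with hTdef
  have hT : T ≠ 0 := by
    simp [hTdef, levelStep, hA₀]
  calc ∫⁻ x in ball x₀ r, localMaximalDev μ f (a x₀ r) r x ∂μ
      ≤ ∫⁻ x in ball x₀ r, ∑' m : ℕ,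
          (devLevelSet μ f a (m * T) x₀ r).indicator (fun _ => T) x ∂μ := by
        refine setLIntegral_mono' measurableSet_ball fun x hx => ?_
        refine iSup₂_le fun y s => iSup₂_le fun hs hxs => ?_
        refine (le_tsum_ite_mul_lt _ hT).trans (ENNReal.tsum_le_tsum fun m => ?_)
        split_ifs with hm
        · rw [Set.indicator_of_mem (show x ∈ devLevelSet μ f a (m * T) x₀ r from
            ⟨hx, y, s, hs, hxs, hm⟩)]
        · exact zero_le
    _ = ∑' m : ℕ, ∫⁻ x in ball x₀ r,
          (devLevelSet μ f a (m * T) x₀ r).indicator (fun _ => T) x ∂μ :=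
        lintegral_tsum fun m =>
          (measurable_const.indicator (isOpen_devLevelSet x₀ r).measurableSet).aemeasurable
    _ ≤ ∑' m : ℕ, T * (2⁻¹ ^ m * μ (ball x₀ r)) := by
        refine ENNReal.tsum_le_tsum fun m => ?_
        refine (setLIntegral_le_lintegral _ _).trans ?_
        rw [lintegral_indicator_const (isOpen_devLevelSet x₀ r).measurableSet]
        gcongr
        exact h.measure_devLevelSet_le hf ha hA₀ hA m x₀ hr
    _ = _ := by
        rw [ENNReal.tsum_mul_left, ENNReal.tsum_mul_right, ENNReal.tsum_geometric,
          ENNReal.one_sub_inv_two, inv_inv]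
        ring


lemma meanDev_le_localMaximalDev {c r : ℝ} {x y : α} {s : ℝ} (hs : s ≤ r) (hx : x ∈ ball y s) :
    meanDev μ f c y s ≤ localMaximalDev μ f c r x :=
  le_iSup₂_of_le y s (le_iSup₂_of_le hs hx le_rfl)

lemma maximalFn_eq_iSup_meanDev (x : α) :
    maximalFn μ f x = ⨆ (y : α) (r : ℝ) (_ : x ∈ ball y r), meanDev μ f 0 y r := by
  simp only [maximalFn, meanDev, sub_zero, Real.enorm_eq_ofReal_abs]

lemma meanDev_zero_le_maximalFn {x y : α} {r : ℝ} (hx : x ∈ ball y r) :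
    meanDev μ f 0 y r ≤ maximalFn μ f x := by
  rw [maximalFn_eq_iSup_meanDev]
  exact le_iSup₂_of_le y r (le_iSup_of_le hx le_rfl)

lemma measurable_maximalFn [OpensMeasurableSpace α] : Measurable (maximalFn μ f) := by
  refine measurable_of_Ioi fun t => IsOpen.measurableSet ?_
  have : maximalFn μ f ⁻¹' Set.Ioi t =
      ⋃ (y : α) (r : ℝ) (_ : t < meanDev μ f 0 y r), ball y r := by
    ext x
    simp only [Set.mem_preimage, Set.mem_Ioi, maximalFn_eq_iSup_meanDev, lt_iSup_iff,
      Set.mem_iUnion, exists_prop, and_comm]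
  rw [this]
  exact isOpen_iUnion fun _ => isOpen_iUnion fun _ => isOpen_iUnion fun _ => isOpen_ball

lemma IsBallDoubling_s19.maximalFn_le_add (h : IsBallDoubling_s19 μ D) {c r : ℝ} {x : α} {M : ℝ≥0∞}
    (hc : ‖c‖ₑ ≤ M) (hM : ∀ y s, r < s → x ∈ ball y s → meanDev μ f 0 y s ≤ M) :
    maximalFn μ f x ≤ localMaximalDev μ f c r x + M := by
  rw [maximalFn_eq_iSup_meanDev]
  refine iSup₂_le fun y s => iSup_le fun hx => ?_
  rcases le_or_gt s r with hs | hs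
  · refine (h.meanDev_le_add 0 c y (pos_of_mem_ball hx)).trans ?_
    rw [sub_zero]
    gcongr
    exact meanDev_le_localMaximalDev hs hx
  · exact (hM y s hs hx).trans le_add_self

/-- Two values of the maximal function on a ball differ by at most the local maximal deviation and
a multiple of the oscillation. -/
lemma IsBallDoubling_s19.maximalFn_le_add_maximalFn (h : IsBallDoubling_s19 μ D) (hf : AEMeasurable f μ)
    {a : α → ℝ → ℝ} {A : ℝ≥0∞} (ha : ∀ y r, 0 < r → meanDev μ f (a y r) y r ≤ A)
    {x₀ x z : α} {r : ℝ} (hx : x ∈ ball x₀ r) (hz : z ∈ ball x₀ r) :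
    maximalFn μ f x ≤
      localMaximalDev μ f (a x₀ r) r x + ((1 + D ^ 2) * A + maximalFn μ f z) := by
  have hconst : ∀ y s, z ∈ ball y s → ‖a y s‖ₑ ≤ A + maximalFn μ f z := fun y s hzs => by
    have hs := pos_of_mem_ball hzs
    have := h.enorm_sub_le hf (a y s) 0 y hs
    rw [sub_zero] at this
    exact this.trans (add_le_add (ha y s hs) (meanDev_zero_le_maximalFn hzs))
  refine h.maximalFn_le_add ((hconst x₀ r hz).trans ?_) fun y s hs hxs => ?_
  · gcongr
    exact le_mul_of_one_le_left' le_self_add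
  · have hs0 := pos_of_mem_ball hxs
    have hzs : z ∈ ball y (2 ^ 2 * s) := by
      rw [mem_ball] at *
      linarith [dist_triangle4 z x₀ x y, dist_comm x x₀]
    have h4 : 0 < 2 ^ 2 * s := by positivity
    have hsub : ball y s ⊆ ball y (2 ^ 2 * s) := ball_subset_ball (by linarith)
    calc _ ≤ _ := h.meanDev_le_add 0 (a y (2 ^ 2 * s)) y hs0
      _ ≤ D ^ 2 * A + (A + maximalFn μ f z) := by
        rw [sub_zero]
        refine add_le_add ?_ (hconst _ _ hzs)
        refine (h.meanDev_le_mul hs0 hsub (h.measure_ball_le hs0 2 (by simp))).trans ?_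
        gcongr
        exact ha _ _ h4
      _ = _ := by ring

/-- On a ball outside of which the concentric averages of `|f|` are bounded, the maximal function
is controlled by the local maximal deviation. -/
lemma IsBallDoubling_s19.maximalFn_le_of_forall_le (h : IsBallDoubling_s19 μ D) (hf : AEMeasurable f μ)
    {a : α → ℝ → ℝ} {A : ℝ≥0∞} (ha : ∀ y r, 0 < r → meanDev μ f (a y r) y r ≤ A)
    {x₀ x : α} {r : ℝ} (hA : ∀ R, r ≤ R → meanDev μ f 0 x₀ R ≤ A) (hx : x ∈ ball x₀ r) :
    maximalFn μ f x ≤ localMaximalDev μ f (a x₀ r) r x + (2 + D ^ 3) * A := by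
  have hr := pos_of_mem_ball hx
  refine h.maximalFn_le_add ?_ fun y s hs hxs => ?_
  · have := h.enorm_sub_le hf (a x₀ r) 0 x₀ hr
    rw [sub_zero] at this
    calc _ ≤ _ := this
      _ ≤ A + A := add_le_add (ha x₀ r hr) (hA r le_rfl)
      _ = 2 * A := by ring
      _ ≤ _ := by gcongr; exact le_self_add
  · have hs0 := pos_of_mem_ball hxs
    have hd : dist x₀ y < 2 * s := by
      rw [mem_ball] at *
      linarith [dist_triangle_left x₀ y x]
    calc _ ≤ D ^ 3 * meanDev μ f 0 x₀ (2 ^ 2 * s) :=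
          h.meanDev_le_mul hs0 (ball_subset_ball' (by rw [dist_comm]; linarith))
            (h.measure_ball_le hs0 3 (by linarith))
      _ ≤ D ^ 3 * A := by gcongr; exact hA _ (by linarith)
      _ ≤ _ := by gcongr; exact le_add_self

/-- The constant bounding the maximal function on `BMO`, up to a factor of two. -/
def maximalBMOConst (D : ℝ≥0∞) : ℝ≥0∞ := 2 * levelStep D 1 + (2 + D ^ 2 + D ^ 3)

lemma levelStep_eq (D A : ℝ≥0∞) : levelStep D A = levelStep D 1 * A := by
  simp only [levelStep, selectionLevel]; ring

lemma IsBallDoubling_s19.lintegral_maximalFn_le [OpensMeasurableSpace α]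
    [SecondCountableTopology α] (h : IsBallDoubling_s19 μ D) (hf : AEMeasurable f μ)
    {a : α → ℝ → ℝ} {A : ℝ≥0∞} (ha : ∀ y r, 0 < r → meanDev μ f (a y r) y r ≤ A)
    (hA₀ : A ≠ 0) (hA : A ≠ ∞) {x₀ : α} {r : ℝ} (hr : 0 < r)
    (hlarge : ∀ R, r ≤ R → meanDev μ f 0 x₀ R ≤ A) :
    ∫⁻ x in ball x₀ r, maximalFn μ f x ∂μ ≤ maximalBMOConst D * A * μ (ball x₀ r) := by
  calc ∫⁻ x in ball x₀ r, maximalFn μ f x ∂μ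
      ≤ ∫⁻ x in ball x₀ r, (localMaximalDev μ f (a x₀ r) r x + (2 + D ^ 3) * A) ∂μ :=
        setLIntegral_mono' measurableSet_ball fun x hx =>
          h.maximalFn_le_of_forall_le hf ha hlarge hx
    _ ≤ 2 * levelStep D A * μ (ball x₀ r) + (2 + D ^ 3) * A * μ (ball x₀ r) := by
        rw [lintegral_add_right _ measurable_const, lintegral_const, Measure.restrict_apply_univ]
        gcongr
        exact h.lintegral_localMaximalDev_le hf ha hA₀ hA x₀ hr
    _ = (2 * levelStep D 1 + (2 + 0 + D ^ 3)) * A * μ (ball x₀ r) := by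
        rw [levelStep_eq]; ring
    _ ≤ _ := by
        unfold maximalBMOConst
        gcongr
        exact zero_le

lemma IsBallDoubling_s19.exists_lintegral_maximalFn_sub_le [OpensMeasurableSpace α]
    [SecondCountableTopology α] (h : IsBallDoubling_s19 μ D) (hf : AEMeasurable f μ)
    {a : α → ℝ → ℝ} {A : ℝ≥0∞} (ha : ∀ y r, 0 < r → meanDev μ f (a y r) y r ≤ A)
    (hA₀ : A ≠ 0) (hA : A ≠ ∞) {x₀ : α} {r : ℝ} (hr : 0 < r)
    (hfin : ∀ᵐ x ∂μ.restrict (ball x₀ r), maximalFn μ f x < ∞) :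
    ∃ c : ℝ, ∫⁻ x in ball x₀ r, ‖(maximalFn μ f x).toReal - c‖ₑ ∂μ ≤
      maximalBMOConst D * A * μ (ball x₀ r) := by
  set m : ℝ≥0∞ := ⨅ z ∈ ball x₀ r, maximalFn μ f z with hm
  have hDt := h.ne_top
  refine ⟨m.toReal, ?_⟩
  calc ∫⁻ x in ball x₀ r, ‖(maximalFn μ f x).toReal - m.toReal‖ₑ ∂μ
      ≤ ∫⁻ x in ball x₀ r, (localMaximalDev μ f (a x₀ r) r x + (1 + D ^ 2) * A) ∂μ := by
        refine lintegral_mono_ae ?_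
        filter_upwards [hfin, ae_restrict_mem measurableSet_ball] with x hx hxB
        have hmx : m ≤ maximalFn μ f x := iInf₂_le x hxB
        rw [← ENNReal.toReal_sub_of_le hmx hx.ne, Real.enorm_eq_ofReal ENNReal.toReal_nonneg,
          ENNReal.ofReal_toReal (ENNReal.sub_ne_top hx.ne), tsub_le_iff_left, add_comm,
          ← tsub_le_iff_left]
        refine le_iInf₂ fun z hz => ?_
        rw [tsub_le_iff_left, add_assoc]
        exact h.maximalFn_le_add_maximalFn hf ha hxB hz
    _ ≤ 2 * levelStep D A * μ (ball x₀ r) + (1 + D ^ 2) * A * μ (ball x₀ r) := by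
        rw [lintegral_add_right _ measurable_const, lintegral_const, Measure.restrict_apply_univ]
        gcongr
        exact h.lintegral_localMaximalDev_le hf ha hA₀ hA x₀ hr
    _ = (2 * levelStep D 1 + (1 + D ^ 2 + 0)) * A * μ (ball x₀ r) := by
        rw [levelStep_eq]; ring
    _ ≤ _ := by
        unfold maximalBMOConst
        gcongr
        · norm_num
        · exact zero_le

lemma setAverage_abs_le {X : Type*} [MeasurableSpace X] {μ : Measure X} {s : Set X} {g : X → ℝ}
    {K : ℝ≥0∞} (hs : μ s ≠ 0) (hs' : μ s ≠ ∞) (hg : AEStronglyMeasurable g (μ.restrict s))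
    (hK : K ≠ ∞) (h : ∫⁻ x in s, ‖g x‖ₑ ∂μ ≤ K * μ s) : ⨍ x in s, |g x| ∂μ ≤ K.toReal := by
  rw [setAverage_eq, smul_eq_mul, Measure.real,
    inv_mul_le_iff₀ (ENNReal.toReal_pos hs hs')]
  simp_rw [← Real.norm_eq_abs]
  rw [integral_norm_eq_lintegral_enorm hg, mul_comm, ← ENNReal.toReal_mul]
  exact ENNReal.toReal_mono (ENNReal.mul_ne_top hK hs') h

lemma setAverage_abs_sub_setAverage_le {X : Type*} [MeasurableSpace X] {μ : Measure X} {s : Set X}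
    {g : X → ℝ} (hs : μ s ≠ 0) (hs' : μ s ≠ ∞) (hg : IntegrableOn g s μ) (c : ℝ) :
    ⨍ x in s, |g x - ⨍ z in s, g z ∂μ| ∂μ ≤ 2 * ⨍ x in s, |g x - c| ∂μ := by
  have : IsFiniteMeasure (μ.restrict s) := ⟨by simpa using hs'.lt_top⟩
  have : NeZero (μ.restrict s) := ⟨by simpa using hs⟩
  unfold average
  set ν := (μ.restrict s Set.univ)⁻¹ • μ.restrict s with hν
  have : IsProbabilityMeasure ν := inferInstance
  have hg' : Integrable g ν := hg.integrable.to_average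
  have hgc : Integrable (fun x => |g x - c|) ν := (hg'.sub (integrable_const c)).abs
  have h1 : |c - ∫ z, g z ∂ν| ≤ ∫ x, |g x - c| ∂ν := by
    calc |c - ∫ z, g z ∂ν| = |∫ z, (g z - c) ∂ν| := by
          rw [integral_sub hg' (integrable_const c), abs_sub_comm]; simp
      _ ≤ _ := abs_integral_le_integral_abs
  calc ∫ x, |g x - ∫ z, g z ∂ν| ∂ν ≤ ∫ x, (|g x - c| + |c - ∫ z, g z ∂ν|) ∂ν :=
        integral_mono (hg'.sub (integrable_const _)).abs (hgc.add (integrable_const _))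
          fun x => abs_sub_le _ _ _
    _ = (∫ x, |g x - c| ∂ν) + |c - ∫ z, g z ∂ν| := by
        rw [integral_add hgc (integrable_const _)]; simp
    _ ≤ _ := by linarith

lemma IsBallDoubling_s19.meanDev_le_ofReal (h : IsBallDoubling_s19 μ D) {c K : ℝ} {y : α} {r : ℝ}
    (hr : 0 < r) (hf : IntegrableOn f (ball y r) μ) (hK : ⨍ x in ball y r, |f x - c| ∂μ ≤ K) :
    meanDev μ f c y r ≤ ENNReal.ofReal K := by
  have hfc : IntegrableOn (fun x => f x - c) (ball y r) μ :=
    hf.sub (integrableOn_const (h.ball_ne_top y r))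
  rw [setAverage_eq, smul_eq_mul, Measure.real, ← ENNReal.toReal_inv] at hK
  refine le_trans (le_of_eq ?_) (ENNReal.ofReal_le_ofReal hK)
  simp_rw [← Real.norm_eq_abs]
  rw [ENNReal.ofReal_mul ENNReal.toReal_nonneg, ENNReal.ofReal_toReal
    (ENNReal.inv_ne_top.2 (h.ball_ne_zero y r hr)),
    ofReal_integral_norm_eq_lintegral_enorm hfc, meanDev]

lemma IsBallDoubling_s19.isBMOL_maximalFn_of_pos [OpensMeasurableSpace α]
    [SecondCountableTopology α] (h : IsBallDoubling_s19 μ D) {ρ : α → ℝ} (hρ : ∀ x, 0 < ρ x)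
    (hf : AEMeasurable f μ) (hfi : ∀ y r, IntegrableOn f (ball y r) μ) {Cf : ℝ} (hCf : 0 < Cf)
    (hfB : IsBMOL μ ρ f Cf) :
    IsBMOL μ ρ (fun x => (maximalFn μ f x).toReal) (2 * (maximalBMOConst D).toReal * Cf) := by
  classical
  have hDt := h.ne_top
  set A := ENNReal.ofReal Cf with hAdef
  have hA₀ : A ≠ 0 := by simpa [hAdef] using hCf
  have hA : A ≠ ∞ := ENNReal.ofReal_ne_top
  have hKt : maximalBMOConst D ≠ ∞ := by
    unfold maximalBMOConst levelStep selectionLevel; finiteness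
  have hKA : maximalBMOConst D * A ≠ ∞ := ENNReal.mul_ne_top hKt hA
  have hKAr : (maximalBMOConst D * A).toReal = (maximalBMOConst D).toReal * Cf := by
    rw [ENNReal.toReal_mul, hAdef, ENNReal.toReal_ofReal hCf.le]
  have hbig : ∀ y r, ρ y ≤ r → meanDev μ f 0 y r ≤ A := fun y r hr =>
    h.meanDev_le_ofReal ((hρ y).trans_le hr) (hfi y r) (by simpa using hfB.2 y r hr)
  set a : α → ℝ → ℝ := fun y r => if r < ρ y then ⨍ z in ball y r, f z ∂μ else 0 with hadef
  have ha : ∀ y r, 0 < r → meanDev μ f (a y r) y r ≤ A := by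
    intro y r hr
    by_cases hlt : r < ρ y
    · simp only [hadef, if_pos hlt]
      exact h.meanDev_le_ofReal hr (hfi y r) (hfB.1 y r hr hlt)
    · simp only [hadef, if_neg hlt]
      exact hbig y r (not_lt.1 hlt)
  have hM : ∀ y r, ρ y ≤ r → ∫⁻ x in ball y r, maximalFn μ f x ∂μ ≤
      maximalBMOConst D * A * μ (ball y r) := fun y r hr =>
    h.lintegral_maximalFn_le hf ha hA₀ hA ((hρ y).trans_le hr) fun R hR => hbig y R (hr.trans hR)
  have hmeas : Measurable fun x => (maximalFn μ f x).toReal :=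
    measurable_maximalFn.ennreal_toReal
  constructor
  · intro y r hr hlt
    have hfin : ∫⁻ x in ball y r, maximalFn μ f x ∂μ ≠ ∞ :=
      ne_top_of_le_ne_top (ENNReal.mul_ne_top hKA (h.ball_ne_top y (ρ y)))
        ((lintegral_mono_set (ball_subset_ball hlt.le)).trans (hM y _ le_rfl))
    obtain ⟨c, hc⟩ := h.exists_lintegral_maximalFn_sub_le hf ha hA₀ hA hr
      (ae_lt_top measurable_maximalFn hfin)
    have hint : IntegrableOn (fun x => (maximalFn μ f x).toReal) (ball y r) μ :=
      integrable_toReal_of_lintegral_ne_top measurable_maximalFn.aemeasurable hfin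
    refine (setAverage_abs_sub_setAverage_le (h.ball_ne_zero y r hr) (h.ball_ne_top y r) hint
      c).trans ?_
    have := setAverage_abs_le (h.ball_ne_zero y r hr) (h.ball_ne_top y r)
      (hmeas.sub_const c).aestronglyMeasurable hKA hc
    rw [hKAr] at this
    linarith
  · intro y r hr
    have h0 := (hρ y).trans_le hr
    have hle := setAverage_abs_le (h.ball_ne_zero y r h0) (h.ball_ne_top y r)
      hmeas.aestronglyMeasurable hKA ((lintegral_mono fun x => by
        rw [Real.enorm_eq_ofReal ENNReal.toReal_nonneg]
        exact ENNReal.ofReal_toReal_le).trans (hM y r hr))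
    rw [hKAr] at hle
    have : 0 ≤ (maximalBMOConst D).toReal * Cf := by positivity
    linarith

lemma IsBMOL.mono {ρ : α → ℝ} {C C' : ℝ} (h : IsBMOL μ ρ f C) (hC : C ≤ C') :
    IsBMOL μ ρ f C' :=
  ⟨fun x s hs hlt => (h.1 x s hs hlt).trans hC, fun x r hr => (h.2 x r hr).trans hC⟩

/-- The maximal function is bounded on `BMO` relative to any positive radius function `ρ`, for a
doubling measure. -/
theorem IsBallDoubling_s19.isBMOL_maximalFn [ProperSpace α] [OpensMeasurableSpace α]
    (h : IsBallDoubling_s19 μ D) {ρ : α → ℝ} (hρ : ∀ x, 0 < ρ x)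
    (hf : LocallyIntegrable f μ) {Cf : ℝ} (hCf : 0 ≤ Cf) (hfB : IsBMOL μ ρ f Cf) :
    IsBMOL μ ρ (fun x => (maximalFn μ f x).toReal) (2 * (maximalBMOConst D).toReal * Cf) := by
  have hfm : AEMeasurable f μ := hf.aestronglyMeasurable.aemeasurable
  have hfi : ∀ y r, IntegrableOn f (ball y r) μ := fun y r =>
    (hf.integrableOn_isCompact (isCompact_closedBall y r)).mono_set ball_subset_closedBall
  have hpos : ∀ ε > 0, IsBMOL μ ρ (fun x => (maximalFn μ f x).toReal)
      (2 * (maximalBMOConst D).toReal * (Cf + ε)) := fun ε hε =>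
    h.isBMOL_maximalFn_of_pos hρ hfm hfi (by linarith) (hfB.mono (by linarith))
  have hlim : Filter.Tendsto (fun ε => 2 * (maximalBMOConst D).toReal * (Cf + ε))
      (nhdsWithin 0 (Set.Ioi 0)) (nhds (2 * (maximalBMOConst D).toReal * Cf)) := by
    have : Continuous fun ε => 2 * (maximalBMOConst D).toReal * (Cf + ε) := by fun_prop
    simpa using (this.tendsto 0).mono_left nhdsWithin_le_nhds
  constructor
  · intro x s hs hlt
    exact ge_of_tendsto hlim (eventually_mem_nhdsWithin.mono fun ε hε => (hpos ε hε).1 x s hs hlt)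
  · intro x r hr
    exact ge_of_tendsto hlim (eventually_mem_nhdsWithin.mono fun ε hε => (hpos ε hε).2 x r hr)

end Doubling

section ReflectionWeight

/-- Every ball contains a comparable sub-ball on which finitely many linear functionals are bounded
below by a multiple of the radius. -/
lemma exists_ball_subset_forall_le_abs_inner {F : Type*} [NormedAddCommGroup F]
    [InnerProductSpace ℝ F] (S : Finset F) (hS : ∀ ζ ∈ S, 1 ≤ ‖ζ‖) :
    ∃ c : ℝ, 0 < c ∧ ∀ (x : F) (r : ℝ), 0 < r → ∃ y, ball y (c * r) ⊆ ball x r ∧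
      ∀ ζ ∈ S, ∀ z ∈ ball y (c * r), c * r ≤ |⟪ζ, z⟫| := by
  classical
  induction S using Finset.induction_on with
  | empty => exact ⟨1, one_pos, fun x r _ => ⟨x, by simp, by simp⟩⟩
  | insert ζ S _ ih =>
    obtain ⟨c, hc, hcS⟩ := ih fun η hη => hS η (Finset.mem_insert_of_mem hη)
    refine ⟨c / 4, by positivity, fun x r hr => ?_⟩
    obtain ⟨y, hy, hyS⟩ := hcS x r hr
    have hs : 0 < c * r := by positivity
    set s := c * r with hsdef
    have h1 : 1 ≤ ‖ζ‖ := hS ζ (Finset.mem_insert_self _ _)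
    have hζ : 0 < ‖ζ‖ := by linarith
    obtain ⟨σ, hσ, hσy⟩ : ∃ σ : ℝ, |σ| = 1 ∧ 0 ≤ σ * ⟪ζ, y⟫ := by
      rcases le_total 0 (⟪ζ, y⟫ : ℝ) with h | h
      · exact ⟨1, by simp, by simpa using h⟩
      · exact ⟨-1, by simp, by simpa using h⟩
    set y' := y + (σ * (s / 2 / ‖ζ‖)) • ζ with hy'
    have hdist : dist y' y = s / 2 := by
      rw [hy', dist_eq_norm, add_sub_cancel_left, norm_smul, Real.norm_eq_abs, abs_mul, hσ, one_mul,
        abs_of_pos (by positivity)]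
      field_simp
    have hsub : ball y' (c / 4 * r) ⊆ ball y s := ball_subset_ball' (by rw [hdist]; linarith)
    refine ⟨y', hsub.trans hy, fun η hη z hz => ?_⟩
    rcases Finset.mem_insert.1 hη with rfl | hη
    · have hin : σ * ⟪η, y'⟫ = σ * ⟪η, y⟫ + s / 2 * ‖η‖ := by
        have hσ2 : σ * σ = 1 := by rw [← abs_mul_abs_self, hσ, one_mul]
        rw [hy', inner_add_right, inner_smul_right, real_inner_self_eq_norm_sq]
        field_simp
        linear_combination s * ‖η‖ * hσ2
      have hz' : |⟪η, z - y'⟫| ≤ ‖η‖ * (s / 4) := by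
        refine (abs_real_inner_le_norm _ _).trans ?_
        gcongr
        rw [← dist_eq_norm]
        linarith [mem_ball.1 hz]
      have h3 : σ * ⟪η, z⟫ = σ * ⟪η, y'⟫ + σ * ⟪η, z - y'⟫ := by
        rw [inner_sub_right]; ring
      have h4 : |σ * ⟪η, z - y'⟫| ≤ ‖η‖ * (s / 4) := by rwa [abs_mul, hσ, one_mul]
      have h5 : |⟪η, z⟫| = |σ * ⟪η, z⟫| := by rw [abs_mul, hσ, one_mul]
      rw [h5]
      refine le_trans ?_ (le_abs_self _)
      nlinarith [abs_le.1 h4]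
    · linarith [hyS η hη z (hsub hz)]

variable {n : ℕ} {Rp : Finset (EuclideanSpace ℝ (Fin n))} {k w : EuclideanSpace ℝ (Fin n) → ℝ}
  {μ : Measure (EuclideanSpace ℝ (Fin n))}

/-- The weight on a ball is controlled by its values on a fixed proportion of the half ball. -/
lemma exists_weight_le (hnorm : ∀ ζ ∈ Rp, ⟪ζ, ζ⟫ = (2 : ℝ)) (hk : ∀ ζ ∈ Rp, 0 ≤ k ζ)
    (hw : ∀ x, w x = ∏ ζ ∈ Rp, |⟪ζ, x⟫| ^ (2 * k ζ)) :
    ∃ c K : ℝ, 0 < c ∧ 0 < K ∧ ∀ (x : EuclideanSpace ℝ (Fin n)) (r : ℝ), 0 < r →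
      ∃ y, ball y (c * r) ⊆ ball x r ∧
        (∃ δ, 0 < δ ∧ ∀ v ∈ ball y (c * r), δ ≤ w v) ∧
        ∀ v ∈ ball y (c * r), ∀ z ∈ ball x (2 * r), w z ≤ K * w v := by
  have hnorm' : ∀ ζ ∈ Rp, ‖ζ‖ ^ 2 = 2 := fun ζ hζ => by
    rw [← real_inner_self_eq_norm_sq]; exact hnorm ζ hζ
  obtain ⟨c, hc, hcS⟩ := exists_ball_subset_forall_le_abs_inner Rp fun ζ hζ => by
    nlinarith [hnorm' ζ hζ, norm_nonneg ζ]
  refine ⟨c, ∏ ζ ∈ Rp, (1 + 6 / c) ^ (2 * k ζ), hc,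
    Finset.prod_pos fun ζ _ => by positivity, fun x r hr => ?_⟩
  obtain ⟨y, hy, hyS⟩ := hcS x r hr
  refine ⟨y, hy, ⟨∏ ζ ∈ Rp, (c * r) ^ (2 * k ζ), Finset.prod_pos fun ζ _ => by positivity,
    fun v hv => ?_⟩, fun v hv z hz => ?_⟩
  · rw [hw]
    refine Finset.prod_le_prod (fun ζ _ => by positivity) fun ζ hζ => ?_
    exact Real.rpow_le_rpow (by positivity) (hyS ζ hζ v hv) (by linarith [hk ζ hζ])
  · rw [hw, hw, ← Finset.prod_mul_distrib]
    refine Finset.prod_le_prod (fun ζ _ => by positivity) fun ζ hζ => ?_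
    rw [← Real.mul_rpow (by positivity) (abs_nonneg _)]
    refine Real.rpow_le_rpow (abs_nonneg _) ?_ (by linarith [hk ζ hζ])
    have hvx := mem_ball.1 (hy hv)
    have hzx := mem_ball.1 hz
    have hlow := hyS ζ hζ v hv
    have hzv : ‖z - v‖ ≤ 3 * r := by
      rw [← dist_eq_norm]
      linarith [dist_triangle_right z v x]
    have h2 : ‖ζ‖ ≤ 2 := by nlinarith [hnorm' ζ hζ, norm_nonneg ζ]
    have hdiff : |⟪ζ, z - v⟫| ≤ 2 * (3 * r) :=
      (abs_real_inner_le_norm _ _).trans (by gcongr)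
    have hsplit : (⟪ζ, z⟫ : ℝ) = ⟪ζ, v⟫ + ⟪ζ, z - v⟫ := by rw [inner_sub_right]; ring
    have hr6 : 2 * (3 * r) ≤ 6 / c * |⟪ζ, v⟫| := by
      calc 2 * (3 * r) = 6 / c * (c * r) := by field_simp; ring
        _ ≤ _ := by gcongr
    calc |⟪ζ, z⟫| ≤ |⟪ζ, v⟫| + |⟪ζ, z - v⟫| := by rw [hsplit]; exact abs_add_le _ _
      _ ≤ (1 + 6 / c) * |⟪ζ, v⟫| := by linarith

/-- The weighted measure attached to a root system is doubling. -/
lemma exists_isBallDoubling_weight (hnorm : ∀ ζ ∈ Rp, ⟪ζ, ζ⟫ = (2 : ℝ))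
    (hk : ∀ ζ ∈ Rp, 0 ≤ k ζ) (hw : ∀ x, w x = ∏ ζ ∈ Rp, |⟪ζ, x⟫| ^ (2 * k ζ))
    (hμ : μ = volume.withDensity fun x => ENNReal.ofReal (w x)) :
    ∃ D : ℝ≥0∞, IsBallDoubling_s19 μ D := by
  obtain ⟨c, K, hc, hK, hcK⟩ := exists_weight_le hnorm hk hw
  have hμball : ∀ x r, μ (ball x r) = ∫⁻ z in ball x r, ENNReal.ofReal (w z) := fun x r => by
    rw [hμ, withDensity_apply _ measurableSet_ball]
  have hupper : ∀ x r y v, v ∈ ball y (c * r) →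
      (∀ v ∈ ball y (c * r), ∀ z ∈ ball x (2 * r), w z ≤ K * w v) →
      μ (ball x (2 * r)) ≤
        ENNReal.ofReal K * ENNReal.ofReal (w v) * volume (ball x (2 * r)) := by
    intro x r y v hv hy
    rw [hμball, ← ENNReal.ofReal_mul hK.le]
    calc _ ≤ ∫⁻ _ in ball x (2 * r), ENNReal.ofReal (K * w v) :=
          setLIntegral_mono' measurableSet_ball fun z hz => ENNReal.ofReal_le_ofReal (hy v hv z hz)
      _ = _ := by simp
  refine ⟨max 1 (ENNReal.ofReal K * ENNReal.ofReal ((2 / c) ^ n)), le_max_left _ _,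
    by finiteness, fun x r hr => ?_, fun x r => ?_, fun x r hr => ?_⟩
  · obtain ⟨y, hsub, ⟨δ, hδ, hδw⟩, -⟩ := hcK x r hr
    have hpos : 0 < ENNReal.ofReal δ * volume (ball y (c * r)) :=
      ENNReal.mul_pos (by simpa using hδ) (measure_ball_pos _ _ (by positivity)).ne'
    refine (hpos.trans_le ?_).ne'
    refine le_trans ?_ (measure_mono hsub)
    rw [hμball]
    calc _ = ∫⁻ _ in ball y (c * r), ENNReal.ofReal δ := by simp
      _ ≤ _ := setLIntegral_mono' measurableSet_ball fun z hz =>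
          ENNReal.ofReal_le_ofReal (hδw z hz)
  · rcases le_or_gt r 0 with hr | hr
    · simp [ball_eq_empty.2 hr]
    · obtain ⟨y, -, -, hy⟩ := hcK x r hr
      refine ne_top_of_le_ne_top ?_ ((measure_mono (ball_subset_ball (by linarith))).trans
        (hupper x r y y (mem_ball_self (by positivity)) hy))
      exact ENNReal.mul_ne_top (by finiteness) measure_ball_lt_top.ne
  · obtain ⟨y, hsub, -, hy⟩ := hcK x r hr
    have hcr : 0 < c * r := by positivity
    set Q := volume (ball y (c * r)) with hQ
    have hQ0 : Q ≠ 0 := (measure_ball_pos _ _ hcr).ne'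
    have hQt : Q ≠ ∞ := measure_ball_lt_top.ne
    have hvol : volume (ball x (2 * r)) = ENNReal.ofReal ((2 / c) ^ n) * Q := by
      have := Measure.addHaar_ball_mul_of_pos volume x (r := 2 / c) (by positivity) (c * r)
      rw [show 2 / c * (c * r) = 2 * r by field_simp] at this
      rw [this, hQ, finrank_euclideanSpace_fin, Measure.addHaar_ball_center,
        Measure.addHaar_ball_center volume y]
    have hint : μ (ball x (2 * r)) * Q ≤
        ENNReal.ofReal K * volume (ball x (2 * r)) * μ (ball y (c * r)) := by
      calc μ (ball x (2 * r)) * Q = ∫⁻ _ in ball y (c * r), μ (ball x (2 * r)) := by simp [hQ]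
        _ ≤ ∫⁻ v in ball y (c * r),
              ENNReal.ofReal K * volume (ball x (2 * r)) * ENNReal.ofReal (w v) :=
            setLIntegral_mono' measurableSet_ball fun v hv =>
              (hupper x r y v hv hy).trans_eq (by ring)
        _ = _ := by
          rw [lintegral_const_mul' _ _
            (ENNReal.mul_ne_top ENNReal.ofReal_ne_top measure_ball_lt_top.ne), hμball]
    rw [hvol] at hint
    have hle : μ (ball x (2 * r)) * Q ≤
        ENNReal.ofReal K * ENNReal.ofReal ((2 / c) ^ n) * μ (ball y (c * r)) * Q :=
      hint.trans_eq (by ring)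
    refine ((ENNReal.mul_le_mul_iff_left hQ0 hQt).1 hle).trans ?_
    gcongr
    exact le_max_right _ _

end ReflectionWeight

/-- **Boundedness of `M_k` on `BMO(𝓛_k)`.**  There is `C > 0` such that for every
`f ∈ BMO(𝓛_k)`, the mean oscillation of `M_k f` on balls `B(x₀, r₀)` with `r₀ < ρ_k(x₀)`
is at most `C ‖f‖_(BMO(𝓛_k))`, and combined with the average bound on large balls,
`M_k f ∈ BMO(𝓛_k)` with `‖M_k f‖_(BMO(𝓛_k)) ≤ C ‖f‖_(BMO(𝓛_k))`. -/
theorem maximal_bounded_on_bmoL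
    (n : ℕ) (hn : 0 < n)
    (Rs Rp : Finset (EuclideanSpace ℝ (Fin n)))
    (hRs0 : (0 : EuclideanSpace ℝ (Fin n)) ∉ Rs)
    (hRsnorm : ∀ ζ ∈ Rs, ⟪ζ, ζ⟫ = (2 : ℝ))
    (hRsrefl : ∀ ζ ∈ Rs, ∀ η ∈ Rs, η - ⟪η, ζ⟫ • ζ ∈ Rs)
    (hRsline : ∀ ζ ∈ Rs, ∀ c : ℝ, c • ζ ∈ Rs → c = 1 ∨ c = -1)
    (b : EuclideanSpace ℝ (Fin n))
    (hRpdef : ∀ ζ ∈ Rs, (ζ ∈ Rp ↔ 0 < ⟪ζ, b⟫)) (hRpsub : Rp ⊆ Rs)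
    (k : EuclideanSpace ℝ (Fin n) → ℝ)
    (hk0 : ∀ ζ ∈ Rs, 0 ≤ k ζ)
    (hkinv : ∀ ζ ∈ Rs, ∀ η ∈ Rs, k (η - ⟪η, ζ⟫ • ζ) = k η)
    (w : EuclideanSpace ℝ (Fin n) → ℝ)
    (hw : ∀ x, w x = ∏ ζ ∈ Rp, |⟪ζ, x⟫| ^ (2 * k ζ))
    (γ : ℝ) (hγ : γ = ∑ ζ ∈ Rp, k ζ)
    (μ : Measure (EuclideanSpace ℝ (Fin n)))
    (hμ : μ = volume.withDensity (fun x => ENNReal.ofReal (w x)))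
    (V : EuclideanSpace ℝ (Fin n) → ℝ)
    (hV0 : ∀ x, 0 ≤ V x)
    (hVloc : LocallyIntegrable V μ)
    (hVne : ¬ (∀ᵐ x ∂μ, V x = 0))
    (q : ℝ) (hq : max 1 (((n : ℝ) + 2 * γ) / 2) < q)
    (C_RH : ℝ) (hC_RH : 0 < C_RH)
    (hRH : ∀ (x : EuclideanSpace ℝ (Fin n)) (r : ℝ), 0 < r →
      (⨍ y in Metric.ball x r, V y ^ q ∂μ) ^ (1 / q) ≤
        C_RH * ⨍ y in Metric.ball x r, V y ∂μ)
    (ρ : EuclideanSpace ℝ (Fin n) → ℝ)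
    (hρdef : ∀ x, ρ x = sSup {r : ℝ | 0 < r ∧
      r ^ 2 / (μ (Metric.ball x r)).toReal * ∫ y in Metric.ball x r, V y ∂μ ≤ 1})
    (hρpos : ∀ x, 0 < ρ x)
    :
    ∃ C : ℝ, 0 < C ∧
      ∀ f : EuclideanSpace ℝ (Fin n) → ℝ, LocallyIntegrable f μ →
      ∀ Cf : ℝ, 0 ≤ Cf → IsBMOL μ ρ f Cf →
      (∀ (x₀ : EuclideanSpace ℝ (Fin n)) (r₀ : ℝ), 0 < r₀ → r₀ < ρ x₀ →
        ⨍ x in Metric.ball x₀ r₀,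
            |(maximalFn μ f x).toReal -
              ⨍ z in Metric.ball x₀ r₀, (maximalFn μ f z).toReal ∂μ| ∂μ ≤ C * Cf) ∧
      IsBMOL μ ρ (fun x => (maximalFn μ f x).toReal) (C * Cf) := by
  obtain ⟨D, hD⟩ := exists_isBallDoubling_weight (fun ζ hζ => hRsnorm ζ (hRpsub hζ))
    (fun ζ hζ => hk0 ζ (hRpsub hζ)) hw hμ
  refine ⟨2 * (maximalBMOConst D).toReal + 1, by positivity, fun f hf Cf hCf hfB => ?_⟩
  have key := (hD.isBMOL_maximalFn hρpos hf hCf hfB).mono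
    (C' := (2 * (maximalBMOConst D).toReal + 1) * Cf) (by linarith)
  exact ⟨key.1, key⟩
end
end
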